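/- Let L/K satisfy condition (ram) with parameter n, and let K_i be the fixed field of G^i for 1 ≤ i ≤ n+1. Then: (a) for 0 ≤ j ≤ i, the Herbrand function satisfies ψ_{K_i/K}(j) = p^j − 1; consequently, for any integer u with p^{j−1} ≤ u ≤ p^j − 1, the lower ramification group H_u of H := Gal(K_i/K) = G/G^i equals the upper ramification group H^j. -/

import Mathlib

noncomputable section

open scoped Classical

/-- An additive `ℚ ∪ {∞}`-valued valuation on a field `A`, normalized by `v p = 1`.
This models the `p`-adic valuation `v_p` on (an algebraic closure of) `ℚ_p`,
with the convention `v 0 = ∞`. -/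
structure PadicValData (A : Type) [Field A] (p : ℕ) : Type where
  v : A → WithTop ℚ
  v_top_iff : ∀ x : A, v x = ⊤ ↔ x = 0
  v_mul : ∀ x y : A, v (x * y) = v x + v y
  v_min_le_add : ∀ x y : A, min (v x) (v y) ≤ v (x + y)
  v_coe_p : v (p : A) = 1

variable {p : ℕ} {A : Type} [Field A]

/-- `x ∈ F` is a uniformizer of the `p`-adic field `F` (embedded in `A` by `emb`):
its valuation is minimal among the positive valuations of elements of `F`. -/
def IsUniformizer (vd : PadicValData A p) {F : Type} [Field F] (emb : F →+* A) (x : F) : Prop :=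
  x ≠ 0 ∧ 0 < vd.v (emb x) ∧
    ∀ y : F, 0 < vd.v (emb y) → vd.v (emb x) ≤ vd.v (emb y)

/-- `y` belongs to the `j`-th power `m_F^j` of the maximal ideal of the ring of integers
`O_F` of `F` (embedded in `A` by `emb`): `y` is a multiple, by an element of `O_F`, of a
product of `j` elements of the maximal ideal `m_F`.  (For `j = 0` this says `y ∈ O_F`.) -/
def InMaxIdealPow (vd : PadicValData A p) {F : Type} [Field F] (emb : F →+* A) (j : ℕ)
    (y : A) : Prop :=
  ∃ (u : F) (s : Fin j → F), 0 ≤ vd.v (emb u) ∧ (∀ k, 0 < vd.v (emb (s k))) ∧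
    y = emb u * ∏ k, emb (s k)

/-- The lower-numbering ramification set
`G_i = {σ ∈ Gal(L/K) | ∀ x ∈ O_L, σ x - x ∈ m_L^{i+1}}` (with `G_i = G` for `i ≤ -1`). -/
def lowerRamSet (vd : PadicValData A p) (K L : Type) [Field K] [Field L] [Algebra K L]
    (emb : L →+* A) (i : ℤ) : Set (L ≃ₐ[K] L) :=
  {σ | ∀ x : L, 0 ≤ vd.v (emb x) →
    InMaxIdealPow vd emb (i + 1).toNat (emb (σ x) - emb x)}

/-- The Herbrand function `φ_{L/K}(u) = ∫_0^u dt / (G_0 : G_t)`, where `G_t = G_{⌈t⌉}`. -/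
noncomputable def herbrandPhi (vd : PadicValData A p) (K L : Type) [Field K] [Field L]
    [Algebra K L] (emb : L →+* A) (u : ℝ) : ℝ :=
  ∫ t in (0:ℝ)..u,
    (Nat.card ↥(lowerRamSet vd K L emb ⌈t⌉) : ℝ) /
      (Nat.card ↥(lowerRamSet vd K L emb 0) : ℝ)

/-- The Herbrand function `ψ_{L/K}`, the inverse of `φ_{L/K}`. -/
noncomputable def herbrandPsi (vd : PadicValData A p) (K L : Type) [Field K] [Field L]
    [Algebra K L] (emb : L →+* A) (w : ℝ) : ℝ :=
  Function.invFun (herbrandPhi vd K L emb) w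

/-- The upper-numbering ramification set `G^i = G_{ψ_{L/K}(i)}` of `Gal(L/K)`. -/
def upperRamSet (vd : PadicValData A p) (K L : Type) [Field K] [Field L] [Algebra K L]
    (emb : L →+* A) (i : ℤ) : Set (L ≃ₐ[K] L) :=
  lowerRamSet vd K L emb ⌈herbrandPsi vd K L emb (i : ℝ)⌉

/-- Condition (ram): the upper ramification groups of `L/K` satisfy
`G = G^{-1} = G^0 ⊇ G^1 ⊋ G^2 ⊋ ⋯ ⊋ G^n ⊋ G^{n+1} = {1}`, with `G^i/G^{i+1}` of order `p`
for `1 ≤ i ≤ n` and `G^0/G^1` of order `p - 1`. -/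
def RamCond (vd : PadicValData A p) (K L : Type) [Field K] [Field L] [Algebra K L]
    (emb : L →+* A) (n : ℕ) : Prop :=
  upperRamSet vd K L emb (-1) = Set.univ ∧
  upperRamSet vd K L emb 0 = Set.univ ∧
  (∀ i : ℤ, upperRamSet vd K L emb (i + 1) ⊆ upperRamSet vd K L emb i) ∧
  Nat.card ↥(upperRamSet vd K L emb 0)
    = (p - 1) * Nat.card ↥(upperRamSet vd K L emb 1) ∧
  (∀ i : ℕ, 1 ≤ i → i ≤ n →
    Nat.card ↥(upperRamSet vd K L emb (i : ℤ))
      = p * Nat.card ↥(upperRamSet vd K L emb ((i : ℤ) + 1))) ∧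
  upperRamSet vd K L emb ((n : ℤ) + 1) = {1}

/-- The local resolvent `⟨α|χ⟩ = ∑_{γ ∈ Gal(L/K)} χ(γ) γ(α)`, computed in `A`. -/
noncomputable def localResolvent (K L : Type) [Field K] [Field L] [Algebra K L]
    (emb : L →+* A) (χ : (L ≃ₐ[K] L) → A) (α : L) : A :=
  ∑ᶠ γ : L ≃ₐ[K] L, χ γ * emb (γ α)

end

namespace HA

theorem exists_int {E : Type} [Field E] (w : AddValuation E (WithTop ℤ)) {z : E} (hz : z ≠ 0) :
    ∃ k : ℤ, w z = (k : WithTop ℤ) := by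
  have h := (w.ne_top_iff (x := z)).2 hz
  obtain ⟨k, hk⟩ := WithTop.ne_top_iff_exists.1 h
  exact ⟨k, hk.symm⟩

theorem ne_zero_of {E : Type} [Field E] (w : AddValuation E (WithTop ℤ)) {z : E} {k : ℤ}
    (hz : w z = (k : WithTop ℤ)) : z ≠ 0 := by
  rintro rfl
  simp at hz

theorem w_inv {E : Type} [Field E] (w : AddValuation E (WithTop ℤ)) {z : E} {k : ℤ}
    (hz : w z = (k : WithTop ℤ)) : w z⁻¹ = ((-k : ℤ) : WithTop ℤ) := by
  have h0 := ne_zero_of w hz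
  obtain ⟨l, hl⟩ := exists_int w (inv_ne_zero h0)
  have : w (z * z⁻¹) = 0 := by rw [mul_inv_cancel₀ h0]; simp
  rw [w.map_mul, hz, hl, ← WithTop.coe_add, ← WithTop.coe_zero, WithTop.coe_inj] at this
  rw [hl, WithTop.coe_inj]; omega

theorem w_pow {E : Type} [Field E] (w : AddValuation E (WithTop ℤ)) {z : E} {k : ℤ}
    (hz : w z = (k : WithTop ℤ)) (n : ℕ) : w (z ^ n) = ((n * k : ℤ) : WithTop ℤ) := by
  rw [w.map_pow, hz, ← WithTop.coe_nsmul]; simp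

theorem w_zpow {E : Type} [Field E] (w : AddValuation E (WithTop ℤ)) {z : E} {k : ℤ}
    (hz : w z = (k : WithTop ℤ)) (n : ℤ) : w (z ^ n) = ((n * k : ℤ) : WithTop ℤ) := by
  obtain ⟨m, rfl | rfl⟩ := n.eq_nat_or_neg
  · rw [zpow_natCast, w_pow w hz]
  · rw [zpow_neg, zpow_natCast, w_inv w (w_pow w hz m)]; congr 1; ring

theorem w_mul {E : Type} [Field E] (w : AddValuation E (WithTop ℤ)) {y z : E} {k l : ℤ}
    (hy : w y = (k : WithTop ℤ)) (hz : w z = (l : WithTop ℤ)) :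
    w (y * z) = ((k + l : ℤ) : WithTop ℤ) := by
  rw [w.map_mul, hy, hz, WithTop.coe_add]

theorem w_div {E : Type} [Field E] (w : AddValuation E (WithTop ℤ)) {y z : E} {k l : ℤ}
    (hy : w y = (k : WithTop ℤ)) (hz : w z = (l : WithTop ℤ)) :
    w (y / z) = ((k - l : ℤ) : WithTop ℤ) := by
  rw [div_eq_mul_inv, w_mul w hy (w_inv w hz), sub_eq_add_neg]

theorem succ_le_of_lt' {a : WithTop ℤ} {k : ℤ} (h : (k : WithTop ℤ) < a) :
    ((k + 1 : ℤ) : WithTop ℤ) ≤ a := by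
  induction a using WithTop.recTopCoe with
  | top => exact le_top
  | coe a => exact WithTop.coe_le_coe.2 (WithTop.coe_lt_coe.1 h)

theorem eq_top_of_forall {a : WithTop ℤ} (h : ∀ k : ℤ, (k : WithTop ℤ) ≤ a) : a = ⊤ := by
  induction a using WithTop.recTopCoe with
  | top => rfl
  | coe a => have := WithTop.coe_le_coe.1 (h (a + 1)); omega

theorem w_prod {E ι : Type} [Field E] (w : AddValuation E (WithTop ℤ)) (S : Finset ι) (f : ι → E) :
    w (∏ i ∈ S, f i) = ∑ i ∈ S, w (f i) := by
  classical
  induction S using Finset.induction_on with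
  | empty => simp
  | insert a S ha ih => rw [Finset.prod_insert ha, Finset.sum_insert ha, w.map_mul, ih]

theorem sum_distinct {E ι : Type} [Field E] (w : AddValuation E (WithTop ℤ)) (S : Finset ι)
    (f : ι → E) (h : ∀ i ∈ S, ∀ j ∈ S, i ≠ j → f i ≠ 0 → w (f i) ≠ w (f j)) :
    w (∑ i ∈ S, f i) = S.inf (fun i => w (f i)) := by
  classical
  induction S using Finset.induction_on with
  | empty => simp
  | insert a S ha ih =>
    have ih' := ih (fun i hi j hj => h i (Finset.mem_insert_of_mem hi) j (Finset.mem_insert_of_mem hj))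
    rw [Finset.sum_insert ha, Finset.inf_insert, ← ih']
    by_cases h0 : f a = 0
    · simp [h0]
    refine w.map_add_of_distinct_val ?_
    rw [ih']
    rcases S.eq_empty_or_nonempty with rfl | hne
    · simpa using h0
    · obtain ⟨i, hi, hie⟩ := Finset.exists_mem_eq_inf S hne (fun i => w (f i))
      rw [hie]
      exact h a (Finset.mem_insert_self _ _) i (Finset.mem_insert_of_mem hi)
        (by rintro rfl; exact ha hi) h0

structure TR (p : ℕ) (K E : Type) [Field K] [Field E] [Algebra K E]
    (w : AddValuation E (WithTop ℤ)) (x : E) : Prop where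
  inv : ∀ (σ : E ≃ₐ[K] E) (z : E), w (σ z) = w z
  unif : w x = ((1 : ℤ) : WithTop ℤ)
  approx : ∀ z : E, w z = ((0 : ℤ) : WithTop ℤ) →
    ∃ c : K, ((0 : ℤ) : WithTop ℤ) < w (z - algebraMap K E c)
  hp : ((0 : ℤ) : WithTop ℤ) < w (p : E)
  hp0 : (p : E) ≠ 0

section
variable {p : ℕ} {K E : Type} [Field K] [Field E] [Algebra K E]
    {w : AddValuation E (WithTop ℤ)} {x : E}

theorem TR.dense (h : TR p K E w x) (e : ℕ) (he : 0 < e) (ϖ : K)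
    (hϖ : w (algebraMap K E ϖ) = ((e : ℤ) : WithTop ℤ)) (z : E) (k : ℤ) 
    (hz : (k : WithTop ℤ) ≤ w z) (N : ℕ) :
    ∃ v ∈ Submodule.span K (Set.range fun j : Fin e => x ^ (j : ℕ)),
      ((k + N : ℤ) : WithTop ℤ) ≤ w (z - v) := by
  induction N with
  | zero => exact ⟨0, Submodule.zero_mem _, by simpa using hz⟩
  | succ N ih =>
    obtain ⟨v, hv, hvw⟩ := ih
    rcases hvw.lt_or_eq with hlt | heq
    · refine ⟨v, hv, ?_⟩
      have := succ_le_of_lt' hlt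
      push_cast at this ⊢
      rwa [add_assoc] at this
    · set m : ℤ := k + N with hm
      have he' : (0 : ℤ) < e := by exact_mod_cast he
      set a := m / e
      set r := (m % e).toNat with hr
      have hr0 : (r : ℤ) = m % e := Int.toNat_of_nonneg (Int.emod_nonneg _ he'.ne')
      have hre : r < e := by have := Int.emod_lt_of_pos m he'; omega
      set t : E := algebraMap K E (ϖ ^ a) * x ^ r with ht
      have hwt : w t = (m : WithTop ℤ) := by
        rw [ht, map_zpow₀, w_mul w (w_zpow w hϖ a) (w_pow w h.unif r)]
        congr 1
        have := Int.mul_ediv_add_emod m e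
        rw [hr0]; linarith
      have ht0 := ne_zero_of w hwt
      obtain ⟨c, hc⟩ := h.approx ((z - v) / t) (by rw [w_div w heq.symm hwt, sub_self])
      refine ⟨v + (c * ϖ ^ a) • x ^ r, Submodule.add_mem _ hv (Submodule.smul_mem _ _
        (Submodule.subset_span ⟨⟨r, hre⟩, rfl⟩)), ?_⟩
      have : z - (v + (c * ϖ ^ a) • x ^ r) = ((z - v) / t - algebraMap K E c) * t := by
        rw [sub_mul, div_mul_cancel₀ _ ht0, Algebra.smul_def, map_mul, ht]; ring
      rw [this, w.map_mul, hwt]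
      have h1 := succ_le_of_lt' hc
      calc ((k + (N + 1 : ℕ) : ℤ) : WithTop ℤ) = ((0 + 1 : ℤ) : WithTop ℤ) + (m : WithTop ℤ) := by
            rw [← WithTop.coe_add]; congr 1; push_cast; omega
        _ ≤ _ := by gcongr

theorem TR.base_dvd [FiniteDimensional K E] [IsGalois K E] (h : TR p K E w x) (c : K) (hc : c ≠ 0) :
    ∃ k : ℤ, w (algebraMap K E c) = ((k * Module.finrank K E : ℤ) : WithTop ℤ) := by
  classical
  have hpK : (algebraMap K E (p : K)) = (p : E) := by simp
  have hex : ∃ k : ℕ, 0 < k ∧ ∃ c : K, w (algebraMap K E c) = ((k : ℤ) : WithTop ℤ) := by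
    obtain ⟨k, hk⟩ := exists_int w h.hp0
    have := h.hp
    rw [hk, WithTop.coe_lt_coe] at this
    refine ⟨k.toNat, by omega, p, ?_⟩
    rw [hpK, hk, Int.toNat_of_nonneg this.le]
  set e := Nat.find hex with he
  obtain ⟨he0, ϖ, hϖ⟩ := Nat.find_spec hex
  rw [← he] at he0 hϖ
  have he' : (0 : ℤ) < e := by exact_mod_cast he0
  have hdvd : ∀ c : K, c ≠ 0 → ∃ k : ℤ, w (algebraMap K E c) = ((k * e : ℤ) : WithTop ℤ) := by
    intro c hc
    obtain ⟨m, hm⟩ := exists_int w (z := algebraMap K E c) (by simpa using hc)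
    refine ⟨m / e, ?_⟩
    have h1 : w (algebraMap K E (c / ϖ ^ (m / e))) = ((m % e : ℤ) : WithTop ℤ) := by
      rw [map_div₀, map_zpow₀, w_div w hm (w_zpow w hϖ _)]
      congr 1
      have := Int.mul_ediv_add_emod m e
      linarith
    have h2 := Int.emod_nonneg m he'.ne'
    have h3 := Int.emod_lt_of_pos m he'
    have h4 : m % e = 0 := by
      by_contra hne
      have := Nat.find_min hex (m := (m % e).toNat) (by omega)
      refine this ⟨by omega, c / ϖ ^ (m / e), ?_⟩
      rw [Int.toNat_of_nonneg h2]; exact h1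
    rw [hm]; congr 1
    have := Int.mul_ediv_add_emod m e
    rw [h4] at this; linarith
  set V := Submodule.span K (Set.range fun j : Fin e => x ^ (j : ℕ)) with hV
  have hVtop : V = ⊤ := by
    by_contra hne
    obtain ⟨f, hf0, hfV⟩ := Submodule.exists_le_ker_of_lt_top V (lt_top_iff_ne_top.2 hne)
    obtain ⟨a, ha⟩ := ((Algebra.traceForm K E).toDual (traceForm_nondegenerate K E)).surjective f
    have hfa : ∀ z, f z = Algebra.trace K E (a * z) := by
      intro z; rw [← ha]; rfl
    have ha0 : a ≠ 0 := by
      rintro rfl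
      apply hf0; ext z; rw [hfa]; simp
    obtain ⟨z, hz⟩ : ∃ z, f z ≠ 0 := by
      by_contra hcon; push Not at hcon
      exact hf0 (LinearMap.ext hcon)
    have hz0 : z ≠ 0 := by rintro rfl; simp at hz
    obtain ⟨d, hd⟩ := exists_int w (z := algebraMap K E (f z)) (by simpa using hz)
    obtain ⟨k, hk⟩ := exists_int w hz0
    obtain ⟨l, hl⟩ := exists_int w ha0
    obtain ⟨v, hv, hvw⟩ := h.dense e he0 ϖ hϖ z k hk.ge (d + 1 - l - k).toNat
    have hfv : f v = 0 := hfV hv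
    have h1 : f z = Algebra.trace K E (a * (z - v)) := by rw [← hfa, map_sub, hfv, sub_zero]
    have h2 : ((d + 1 : ℤ) : WithTop ℤ) ≤ w (algebraMap K E (f z)) := by
      rw [h1, trace_eq_sum_automorphisms]
      refine w.map_le_sum fun σ _ => ?_
      rw [h.inv, w.map_mul, hl]
      calc ((d + 1 : ℤ) : WithTop ℤ) ≤ (l : WithTop ℤ) + ((k + (d + 1 - l - k).toNat : ℤ) : WithTop ℤ) := by
            rw [← WithTop.coe_add, WithTop.coe_le_coe]; omega
        _ ≤ _ := by gcongr
    rw [hd, WithTop.coe_le_coe] at h2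
    omega
  have hle : Module.finrank K E ≤ e := by
    have := finrank_range_le_card (R := K) (fun j : Fin e => x ^ (j : ℕ))
    rw [Set.finrank, ← hV, hVtop, finrank_top, Fintype.card_fin] at this
    exact this
  have hx0 := ne_zero_of w h.unif
  have hnorm : w (algebraMap K E (Algebra.norm K x)) = ((Module.finrank K E : ℤ) : WithTop ℤ) := by
    rw [Algebra.norm_eq_prod_automorphisms, w_prod, Finset.sum_congr rfl (fun σ _ => (h.inv σ x).trans h.unif)]
    rw [Finset.sum_const, ← WithTop.coe_nsmul, Finset.card_univ, ← Nat.card_eq_fintype_card,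
      IsGalois.card_aut_eq_finrank]
    simp
  have heq : e = Module.finrank K E := by
    refine le_antisymm ?_ hle
    refine Nat.find_min' hex ⟨Module.finrank_pos, _, hnorm⟩
  rw [← heq]; exact hdvd c hc

theorem TR.repr [FiniteDimensional K E] [IsGalois K E] (h : TR p K E w x) (z : E)
    (hz : ((0 : ℤ) : WithTop ℤ) ≤ w z) :
    ∃ c : Fin (Module.finrank K E) → K, (∀ j, ((0 : ℤ) : WithTop ℤ) ≤ w (algebraMap K E (c j))) ∧
      z = ∑ j, algebraMap K E (c j) * x ^ (j : ℕ) := by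
  set d := Module.finrank K E with hd
  have key : ∀ c : Fin d → K, w (∑ j, algebraMap K E (c j) * x ^ (j : ℕ)) =
      Finset.univ.inf (fun j => w (algebraMap K E (c j) * x ^ (j : ℕ))) := by
    intro c
    refine sum_distinct w _ _ ?_
    intro i _ j _ hij hne heq
    have hci : c i ≠ 0 := by intro h0; simp [h0] at hne
    have hx0 := ne_zero_of w h.unif
    have hcj : c j ≠ 0 := by
      intro h0
      rw [h0] at heq
      simp only [map_zero, zero_mul, AddValuation.map_zero] at heq
      exact hne (w.top_iff.1 heq)
    obtain ⟨k, hk⟩ := h.base_dvd _ hci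
    obtain ⟨l, hl⟩ := h.base_dvd _ hcj
    rw [w_mul w hk (w_pow w h.unif _), w_mul w hl (w_pow w h.unif _), WithTop.coe_inj, ← hd] at heq
    have hi := i.2
    have hj := j.2
    apply hij
    have h1 : (((i : ℕ) : ℤ) - (j : ℕ)) = (l - k) * d := by linarith
    have h2 : ((d : ℕ) : ℤ) ∣ (((i : ℕ) : ℤ) - (j : ℕ)) := ⟨l - k, by rw [h1]; ring⟩
    have := Int.eq_zero_of_abs_lt_dvd h2 (by rw [abs_lt]; constructor <;> omega)
    ext; omega
  have hli : LinearIndependent K (fun j : Fin d => x ^ (j : ℕ)) := by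
    rw [Fintype.linearIndependent_iff]
    intro g hg i
    simp only [Algebra.smul_def] at hg
    have h1 := key g
    rw [hg, w.map_zero] at h1
    have h2 : (⊤ : WithTop ℤ) ≤ w (algebraMap K E (g i) * x ^ (i : ℕ)) := by
      rw [h1]; exact Finset.inf_le (f := fun j : Fin d => w (algebraMap K E (g j) * x ^ (j : ℕ))) (Finset.mem_univ i)
    have h3 := w.top_iff.1 (top_le_iff.1 h2)
    have hx0 := ne_zero_of w h.unif
    simpa [hx0] using h3
  have : Nonempty (Fin d) := ⟨⟨0, Module.finrank_pos⟩⟩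
  set B := basisOfLinearIndependentOfCardEqFinrank hli (by simp [hd]) with hB
  have hsum := B.sum_repr z
  simp only [hB, coe_basisOfLinearIndependentOfCardEqFinrank, Algebra.smul_def] at hsum
  refine ⟨fun j => B.repr z j, ?_, hsum.symm⟩
  intro j
  by_cases hc : B.repr z j = 0
  · simp [hc]
  obtain ⟨k, hk⟩ := h.base_dvd _ hc
  have h1 : ((0 : ℤ) : WithTop ℤ) ≤ w (algebraMap K E (B.repr z j) * x ^ (j : ℕ)) := by
    refine hz.trans ?_
    conv_lhs => rw [← hsum]
    rw [key]
    exact Finset.inf_le (f := fun j : Fin d => w (algebraMap K E (B.repr z j) * x ^ (j : ℕ))) (Finset.mem_univ j)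
  rw [w_mul w hk (w_pow w h.unif _), WithTop.coe_le_coe, ← hd] at h1
  rw [hk, WithTop.coe_le_coe, ← hd]
  have hj := j.2
  have : -1 < k := by
    by_contra hcon
    have : k * d ≤ -1 * d := by
      apply mul_le_mul_of_nonneg_right (by omega) (by omega)
    omega
  exact mul_nonneg (by omega) (by omega)

theorem TR.le_sub [FiniteDimensional K E] [IsGalois K E] (h : TR p K E w x) (σ : E ≃ₐ[K] E) (z : E)
    (hz : ((0 : ℤ) : WithTop ℤ) ≤ w z) : w (σ x - x) ≤ w (σ z - z) := by
  obtain ⟨c, hc, rfl⟩ := h.repr z hz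
  rw [map_sum, ← Finset.sum_sub_distrib]
  refine w.map_le_sum fun j _ => ?_
  rw [map_mul, AlgEquiv.commutes, map_pow, ← mul_sub, ← geom_sum₂_mul, w.map_mul, w.map_mul]
  have h1 : ((0 : ℤ) : WithTop ℤ) ≤ w (∑ i ∈ Finset.range (j : ℕ), σ x ^ i * x ^ ((j : ℕ) - 1 - i)) := by
    refine w.map_le_sum fun i _ => ?_
    rw [w_mul w (w_pow w ((h.inv σ x).trans h.unif) i) (w_pow w h.unif _), WithTop.coe_le_coe]
    positivity
  calc w (σ x - x) = ((0 : ℤ) : WithTop ℤ) + (((0 : ℤ) : WithTop ℤ) + w (σ x - x)) := by simp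
    _ ≤ _ := by gcongr; exact hc j

end
end HA

namespace HA
open Polynomial

theorem exists_div {R E : Type} [CommRing R] [LinearOrder R] [IsStrictOrderedRing R] [Field E]
    (v : AddValuation E (WithTop R)) (c : R) (hc : 0 < c)
    (h : ∀ z : E, z ≠ 0 → ∃ k : ℤ, v z = ((k * c : R) : WithTop R)) :
    ∃ w : AddValuation E (WithTop ℤ), ∀ (z : E) (k : ℤ),
      w z = (k : WithTop ℤ) ↔ v z = ((k * c : R) : WithTop R) := by
  classical
  choose! g hg using h
  have inj : ∀ k l : ℤ, ((k * c : R) : WithTop R) = ((l * c : R) : WithTop R) → k = l := by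
    intro k l hkl
    rw [WithTop.coe_inj] at hkl
    exact_mod_cast mul_right_cancel₀ hc.ne' hkl
  have le_iff : ∀ k l : ℤ, ((k * c : R) : WithTop R) ≤ ((l * c : R) : WithTop R) ↔ k ≤ l := by
    intro k l
    rw [WithTop.coe_le_coe, mul_le_mul_iff_of_pos_right hc, Int.cast_le]
  have g1 : g 1 = 0 := by
    apply inj
    rw [← hg 1 one_ne_zero, v.map_one]; simp
  have gmul : ∀ y z, y ≠ 0 → z ≠ 0 → g (y * z) = g y + g z := by
    intro y z hy hz
    apply inj
    rw [← hg _ (mul_ne_zero hy hz), v.map_mul, hg y hy, hg z hz, ← WithTop.coe_add]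
    congr 1; push_cast; ring
  refine ⟨AddValuation.of (fun z => if z = 0 then (⊤ : WithTop ℤ) else (g z : WithTop ℤ)) (by simp)
    (by simp [g1]) ?_ ?_, ?_⟩
  · intro y z
    by_cases hy : y = 0
    · simp [hy]
    by_cases hz : z = 0
    · simp [hz]
    by_cases hyz : y + z = 0
    · simp [hyz]
    simp only [hy, hz, hyz, if_false]
    have := v.map_add y z
    rw [hg y hy, hg z hz, hg _ hyz] at this
    rw [min_le_iff] at this ⊢
    rw [le_iff, le_iff] at this
    rwa [WithTop.coe_le_coe, WithTop.coe_le_coe]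
  · intro y z
    by_cases hy : y = 0
    · simp [hy]
    by_cases hz : z = 0
    · simp [hz]
    simp only [hy, hz, mul_ne_zero hy hz, if_false]
    rw [gmul y z hy hz, WithTop.coe_add]
  · intro z k
    rw [AddValuation.of_apply]
    by_cases hz : z = 0
    · simp [hz, -WithTop.coe_mul]
    · simp only [hz, if_false]
      rw [hg z hz, WithTop.coe_inj]
      exact ⟨fun h => by rw [h], fun h => inj _ _ h⟩

theorem integral_prod {E ι : Type} [Field E] (w : AddValuation E (WithTop ℤ)) (S : Finset ι)
    (f : ι → E[X]) (h : ∀ i ∈ S, ∀ j, ((0 : ℤ) : WithTop ℤ) ≤ w ((f i).coeff j)) (j : ℕ) :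
    ((0 : ℤ) : WithTop ℤ) ≤ w ((∏ i ∈ S, f i).coeff j) := by
  classical
  induction S using Finset.induction_on generalizing j with
  | empty => 
    simp only [Finset.prod_empty, coeff_one]
    split_ifs <;> simp
  | insert a S ha ih =>
    rw [Finset.prod_insert ha, coeff_mul]
    refine w.map_le_sum fun i _ => ?_
    rw [w.map_mul]
    have h1 := h a (Finset.mem_insert_self _ _) i.1
    have h2 := ih (fun i hi => h i (Finset.mem_insert_of_mem hi)) i.2
    rw [WithTop.coe_zero] at *
    exact add_nonneg h1 h2

theorem integral_eval {E : Type} [Field E] (w : AddValuation E (WithTop ℤ)) (P : E[X]) (a : E)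
    (ha : ((0 : ℤ) : WithTop ℤ) ≤ w a) (m : WithTop ℤ)
    (h : ∀ j, m ≤ w (P.coeff j)) : m ≤ w (P.eval a) := by
  rw [eval_eq_sum_range]
  refine w.map_le_sum fun i _ => ?_
  rw [w.map_mul, w.map_pow]
  rw [WithTop.coe_zero] at ha
  calc m = m + 0 := by simp
    _ ≤ _ := by gcongr; exact h i; exact nsmul_nonneg ha i

theorem roots_le {E ι : Type} [Field E] (w : AddValuation E (WithTop ℤ)) (S : Finset ι) (r : ι → E)
    (hr : ∀ i ∈ S, ((0 : ℤ) : WithTop ℤ) ≤ w (r i)) (hinj : Set.InjOn r S) (a : E)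
    (ha : ((0 : ℤ) : WithTop ℤ) ≤ w a) (P : E[X]) (hP : ∀ j, ((0 : ℤ) : WithTop ℤ) ≤ w (P.coeff j))
    (hroot : ∀ i ∈ S, P.eval (r i) = 0) : ∑ i ∈ S, w (a - r i) ≤ w (P.eval a) := by
  classical
  induction S using Finset.induction_on generalizing P with
  | empty => 
    simp only [Finset.sum_empty]
    exact integral_eval w P a ha _ hP
  | insert b S hb ih =>
    set Q := P /ₘ (X - C (r b)) with hQ
    have hPQ : (X - C (r b)) * Q = P := 
      mul_divByMonic_eq_iff_isRoot.2 (hroot b (Finset.mem_insert_self _ _))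
    have hQc : ∀ j, ((0 : ℤ) : WithTop ℤ) ≤ w (Q.coeff j) := by
      intro j
      rw [hQ, coeff_divByMonic_X_sub_C]
      refine w.map_le_sum fun i _ => ?_
      rw [w.map_mul, w.map_pow]
      have h1 := hr b (Finset.mem_insert_self _ _)
      have h2 := hP i
      rw [WithTop.coe_zero] at *
      exact add_nonneg (nsmul_nonneg h1 _) h2
    have hQr : ∀ i ∈ S, Q.eval (r i) = 0 := by
      intro i hi
      have h1 := hroot i (Finset.mem_insert_of_mem hi)
      rw [← hPQ, eval_mul, mul_eq_zero] at h1
      refine h1.resolve_left ?_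
      simp only [eval_sub, eval_X, eval_C, sub_ne_zero]
      intro heq
      have := hinj (Finset.mem_coe.2 (Finset.mem_insert_of_mem hi)) (Finset.mem_coe.2 (Finset.mem_insert_self _ _)) heq
      exact hb (this ▸ hi)
    have := ih (fun i hi => hr i (Finset.mem_insert_of_mem hi))
      (hinj.mono (by simp)) Q hQc hQr
    rw [Finset.sum_insert hb, ← hPQ, eval_mul, w.map_mul]
    simp only [eval_sub, eval_X, eval_C]
    gcongr

section
variable {p : ℕ} {K E : Type} [Field K] [Field E] [Algebra K E]
    {w : AddValuation E (WithTop ℤ)} {x : E}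

theorem TR.faithful [FiniteDimensional K E] [IsGalois K E] (h : TR p K E w x) (σ : E ≃ₐ[K] E)
    (hσ : σ x = x) : σ = 1 := by
  have key : ∀ z : E, ((0 : ℤ) : WithTop ℤ) ≤ w z → σ z = z := by
    intro z hz
    have := h.le_sub σ z hz
    rw [hσ, sub_self, w.map_zero, top_le_iff, w.top_iff, sub_eq_zero] at this
    exact this
  ext z
  rw [AlgEquiv.one_apply]
  by_cases hz : z = 0
  · simp [hz]
  obtain ⟨k, hk⟩ := exists_int w hz
  rcases le_total 0 k with h0 | h0
  · exact key z (by rw [hk]; exact_mod_cast h0)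
  · have := key z⁻¹ (by rw [w_inv w hk, WithTop.coe_le_coe]; omega)
    rw [map_inv₀] at this
    exact inv_injective this

theorem TR.quotient [FiniteDimensional K E] [IsGalois K E] (h : TR p K E w x)
    (M : IntermediateField K E) [IsGalois K M] :
    ∃ (wM : AddValuation M (WithTop ℤ)) (y : M), TR p K M wM y ∧
      (∀ z : M, w (z : E) = Module.finrank M E • wM z) ∧
      ∀ s : E ≃ₐ[K] E, ∑ t : E ≃ₐ[M] E, w (s (t x) - x) =
        Module.finrank M E • wM (s.restrictNormal M y - y) := by
  classical
  set q := Module.finrank M E with hq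
  have hq0 : 0 < q := Module.finrank_pos
  have hM : TR p M E w x :=
    { inv := fun σ z => h.inv (σ.restrictScalars K) z
      unif := h.unif
      approx := fun z hz => by
        obtain ⟨c, hc⟩ := h.approx z hz
        exact ⟨algebraMap K M c, hc⟩
      hp := h.hp
      hp0 := h.hp0 }
  obtain ⟨wM, hwM⟩ := exists_div (w.comap (algebraMap M E)) (q : ℤ) (by exact_mod_cast hq0)
    (fun z hz => hM.base_dvd z hz)
  have hrel : ∀ z : M, w (z : E) = q • wM z := by
    intro z
    by_cases hz : z = 0
    · subst hz
      simp only [ZeroMemClass.coe_zero, AddValuation.map_zero]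
      obtain ⟨n, hn⟩ : ∃ n, q = n + 1 := ⟨q - 1, by omega⟩
      rw [hn, succ_nsmul, add_top]
    · obtain ⟨k, hk⟩ := exists_int wM hz
      have := (hwM z k).1 hk
      rw [hk, ← WithTop.coe_nsmul]
      refine Eq.trans this ?_
      congr 1; simp; ring
  have hnn : ∀ z : M, ((0 : ℤ) : WithTop ℤ) ≤ w (z : E) → ((0 : ℤ) : WithTop ℤ) ≤ wM z := by
    intro z h0
    by_cases hz : z = 0
    · simp [hz]
    obtain ⟨k, hk⟩ := exists_int wM hz
    rw [hrel, hk, ← WithTop.coe_nsmul, WithTop.coe_le_coe] at h0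
    rw [hk, WithTop.coe_le_coe]
    simp only [nsmul_eq_mul] at h0
    by_contra hcon
    have : (q : ℤ) * k < 0 := mul_neg_of_pos_of_neg (by exact_mod_cast hq0) (by omega)
    omega
  have hpos : ∀ z : M, ((0 : ℤ) : WithTop ℤ) < w (z : E) → ((0 : ℤ) : WithTop ℤ) < wM z := by
    intro z h0
    refine lt_of_le_of_ne (hnn z h0.le) ?_
    intro heq
    rw [hrel, ← heq, ← WithTop.coe_nsmul] at h0
    simp at h0
  set y : M := Algebra.norm M x with hy
  have hyw : w (y : E) = ((q : ℤ) : WithTop ℤ) := by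
    have : (y : E) = algebraMap M E (Algebra.norm M x) := rfl
    rw [this, Algebra.norm_eq_prod_automorphisms, w_prod, Finset.sum_congr rfl (fun σ _ => (hM.inv σ x).trans h.unif)]
    rw [Finset.sum_const, ← WithTop.coe_nsmul, Finset.card_univ, ← Nat.card_eq_fintype_card,
      IsGalois.card_aut_eq_finrank]
    simp [hq]
  have hMK : TR p K M wM y :=
    { inv := by
        intro σ z
        by_cases hz : z = 0
        · simp [hz]
        obtain ⟨k, hk⟩ := exists_int wM hz
        rw [hk, hwM, ← (hwM z k).1 hk]
        change w (algebraMap M E (σ z)) = w (algebraMap M E z)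
        rw [← AlgEquiv.liftNormal_commutes σ E z, h.inv]
      unif := by
        rw [hwM]
        refine hyw.trans ?_
        simp
      approx := by
        intro z hz
        obtain ⟨c, hc⟩ := h.approx z (by rw [hrel, hz, ← WithTop.coe_nsmul]; simp)
        exact ⟨c, hpos _ hc⟩
      hp := hpos _ (by simpa using h.hp)
      hp0 := by
        intro h0
        apply h.hp0
        have := congrArg (algebraMap M E) h0
        simpa using this }
  refine ⟨wM, y, hMK, hrel, ?_⟩
  intro s
  have hres : ∀ z : M, ((s.restrictNormal M z : M) : E) = s (z : E) := 
    fun z => AlgEquiv.restrictNormal_commutes s M z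
  have hx0 : ((0 : ℤ) : WithTop ℤ) ≤ w x := by rw [h.unif, WithTop.coe_le_coe]; norm_num
  have hsx : ∀ t : E ≃ₐ[M] E, ((0 : ℤ) : WithTop ℤ) ≤ w (s (t x)) := by
    intro t; rw [h.inv, hM.inv]; exact hx0
  rw [← hrel]
  push_cast
  rw [hres]
  apply le_antisymm
  · -- roots
    obtain ⟨c, hc, hcy⟩ := h.repr (y : E) (by rw [hyw, WithTop.coe_le_coe]; omega)
    set P : E[X] := (∑ j, C (algebraMap K E (c j)) * X ^ (j : ℕ)) - C (s y) with hP
    have hev : ∀ a : E, P.eval a = (∑ j, algebraMap K E (c j) * a ^ (j : ℕ)) - s y := by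
      intro a; simp [hP, eval_finsetSum]
    have h1 := roots_le w Finset.univ (fun t : E ≃ₐ[M] E => s (t x)) (fun t _ => hsx t) ?_ x hx0 P ?_ ?_
    · rw [hev, ← hcy, w.map_sub_swap] at h1
      refine le_trans (le_of_eq (Finset.sum_congr rfl fun t _ => w.map_sub_swap _ _)) h1
    · intro t _ t' _ htt
      have h2 : t x = t' x := s.injective htt
      have h3 : t'⁻¹ * t = 1 := hM.faithful _ (by
        rw [AlgEquiv.mul_apply, h2, ← AlgEquiv.mul_apply, inv_mul_cancel, AlgEquiv.one_apply])
      rw [inv_mul_eq_one] at h3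
      exact h3.symm
    · intro j
      rw [hP, coeff_sub]
      refine w.map_le_sub ?_ ?_
      · rw [finsetSum_coeff]
        refine w.map_le_sum fun i _ => ?_
        rw [coeff_C_mul_X_pow]
        split_ifs
        · exact hc i
        · simp
      · rw [coeff_C]
        split_ifs
        · rw [h.inv, hyw, WithTop.coe_le_coe]; omega
        · simp
    · intro t _
      rw [hev, sub_eq_zero]
      have : s (y : E) = s (t (y : E)) := by
        congr 1; exact (t.commutes y).symm
      rw [this, hcy]
      have htK : ∀ c : K, t (algebraMap K E c) = algebraMap K E c := fun c => (t.restrictScalars K).commutes c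
      simp only [map_sum, map_mul, map_pow, AlgEquiv.commutes, htK]
  · set f : E[X] := ∏ t : E ≃ₐ[M] E, (X - C (t x)) with hf
    have hfix : ∀ τ : E ≃ₐ[M] E, f.map (τ : E →+* E) = f := by
      intro τ
      rw [hf, Polynomial.map_prod]
      refine Fintype.prod_equiv (Equiv.mulLeft τ) _ _ ?_
      intro t; simp
    have hcoef : ∀ j, ∃ a : M, (a : E) = f.coeff j := by
      intro j
      have : f.coeff j ∈ Set.range (algebraMap M E) := by
        rw [IsGalois.mem_range_algebraMap_iff_fixed]
        intro τ
        conv_rhs => rw [← hfix τ]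
        rw [coeff_map]; rfl
      exact this
    have hfc : ∀ j, ((0 : ℤ) : WithTop ℤ) ≤ w (f.coeff j) := by
      refine integral_prod w _ _ ?_
      intro t _ j
      rw [coeff_sub]
      refine w.map_le_sub ?_ ?_
      · rw [coeff_X]; split_ifs <;> simp
      · rw [coeff_C]; split_ifs
        · rw [hM.inv]; exact hx0
        · simp
    have h1 : w (s (y : E) - y) ≤ w ((f.map (s : E →+* E) - f).eval x) := by
      refine integral_eval w _ x hx0 _ ?_
      intro j
      obtain ⟨a, ha⟩ := hcoef j
      rw [coeff_sub, coeff_map, ← ha]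
      have h2 := hMK.le_sub (s.restrictNormal M) a (hnn a (by rw [ha]; exact hfc j))
      have h3 := nsmul_le_nsmul_right h2 q
      rw [← hrel, ← hrel] at h3
      push_cast at h3
      rw [hres, hres] at h3
      exact h3
    refine h1.trans (le_of_eq ?_)
    have h2 : f.eval x = 0 := by
      rw [hf, eval_prod]
      exact Finset.prod_eq_zero (Finset.mem_univ 1) (by simp)
    rw [eval_sub, h2, sub_zero, hf, Polynomial.map_prod, eval_prod, w_prod]
    refine Finset.sum_congr rfl fun t _ => ?_
    rw [w.map_sub_swap]
    simp

end
end HA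

namespace HA

section
variable {p : ℕ} {K E : Type} [Field K] [Field E] [Algebra K E]
    {w : AddValuation E (WithTop ℤ)} {x : E}

theorem TR.i_mul (h : TR p K E w x) (σ τ : E ≃ₐ[K] E) :
    min (w (σ x - x)) (w (τ x - x)) ≤ w ((σ * τ) x - x) := by
  have : (σ * τ) x - x = (σ x - x) + σ (τ x - x) := by
    rw [AlgEquiv.mul_apply, map_sub]; ring
  rw [this, ← h.inv σ (τ x - x)]
  exact w.map_add _ _

theorem TR.i_inv (h : TR p K E w x) (σ : E ≃ₐ[K] E) :
    w (σ⁻¹ x - x) = w (σ x - x) := by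
  rw [← h.inv σ (σ⁻¹ x - x), map_sub, ← AlgEquiv.mul_apply, mul_inv_cancel, AlgEquiv.one_apply,
    w.map_sub_swap]

theorem TR.i_pow (h : TR p K E w x) (σ : E ≃ₐ[K] E) (k : ℕ) :
    w (σ x - x) ≤ w ((σ ^ k) x - x) := by
  induction k with
  | zero => simp
  | succ k ih =>
    rw [pow_succ]
    exact le_trans (le_min ih le_rfl) (h.i_mul _ _)

theorem TR.i_pos (h : TR p K E w x) (σ : E ≃ₐ[K] E) : ((1 : ℤ) : WithTop ℤ) ≤ w (σ x - x) :=
  w.map_le_sub (by rw [h.inv, h.unif]) h.unif.ge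

theorem TR.w_sub (h : TR p K E w x) (σ : E ≃ₐ[K] E) (z : E) : w z ≤ w (σ z - z) :=
  w.map_le_sub (by rw [h.inv]) le_rfl

noncomputable def XX (σ : E ≃ₐ[K] E) (x : E) (m : ℕ) : E := ∏ i ∈ Finset.range m, (σ ^ i) x

theorem TR.XX_w (h : TR p K E w x) (σ : E ≃ₐ[K] E) (m : ℕ) :
    w (XX σ x m) = ((m : ℤ) : WithTop ℤ) := by
  rw [XX, w_prod, Finset.sum_congr rfl (fun i _ => (h.inv (σ ^ i) x).trans h.unif),
    Finset.sum_const, ← WithTop.coe_nsmul]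
  simp

theorem TR.XX_sub (h : TR p K E w x) (σ : E ≃ₐ[K] E) (m : ℕ) :
    w (σ (XX σ x m) - XX σ x m) = ((m - 1 : ℤ) : WithTop ℤ) + w ((σ ^ m) x - x) := by
  have hx0 := ne_zero_of w h.unif
  have h1 : σ (XX σ x m) * x = XX σ x m * (σ ^ m) x := by
    have h2 : XX σ x (m + 1) = XX σ x m * (σ ^ m) x := by rw [XX, XX, Finset.prod_range_succ]
    have h3 : XX σ x (m + 1) = σ (XX σ x m) * x := by
      rw [XX, XX, Finset.prod_range_succ', map_prod]
      congr 1
      refine Finset.prod_congr rfl fun i _ => ?_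
      rw [pow_succ', AlgEquiv.mul_apply]
    rw [← h3, h2]
  have h4 : σ (XX σ x m) - XX σ x m = (XX σ x m / x) * ((σ ^ m) x - x) := by
    field_simp
    linear_combination h1
  rw [h4, w.map_mul, w_div w (h.XX_w σ m) h.unif]

theorem TR.i_pow_coprime (h : TR p K E w x) (hp : p.Prime) (σ : E ≃ₐ[K] E) (r : ℕ)
    (hr : σ ^ p ^ r = 1) (j k : ℕ) (hk : ¬ p ∣ k) :
    w ((σ ^ (p ^ j * k)) x - x) = w ((σ ^ p ^ j) x - x) := by
  refine le_antisymm ?_ (by rw [pow_mul]; exact h.i_pow _ _)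
  set τ := σ ^ p ^ j with hτ
  have h1 : τ ^ p ^ r = 1 := by rw [hτ, ← pow_mul, mul_comm, pow_mul, hr, one_pow]
  have h2 : k.Coprime (orderOf τ) := by
    refine Nat.Coprime.coprime_dvd_right (orderOf_dvd_of_pow_eq_one h1) ?_
    exact Nat.Coprime.pow_right r ((Nat.Prime.coprime_iff_not_dvd hp).2 hk).symm
  obtain ⟨m, hm⟩ := exists_pow_eq_self_of_coprime h2
  rw [pow_mul, ← hτ]
  conv_rhs => rw [← hm]
  exact h.i_pow _ _

theorem TR.wild_le (h : TR p K E w x) (σ : E ≃ₐ[K] E) (hσ : ((2 : ℤ) : WithTop ℤ) ≤ w (σ x - x))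
    (z : E) (k : ℕ) (hz : ((k : ℤ) : WithTop ℤ) ≤ w z) :
    ((k + 1 : ℤ) : WithTop ℤ) ≤ w (σ z - z) := by
  rcases hz.lt_or_eq with hlt | heq
  · exact (succ_le_of_lt' hlt).trans (h.w_sub σ z)
  have hx0 := ne_zero_of w h.unif
  have hxk : w (x ^ k) = ((k : ℤ) : WithTop ℤ) := by rw [w_pow w h.unif]; simp
  obtain ⟨c, hc⟩ := h.approx (z / x ^ k) (by rw [w_div w heq.symm hxk, sub_self])
  set r := (z / x ^ k - algebraMap K E c) * x ^ k with hr
  have hzr : z = algebraMap K E c * x ^ k + r := by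
    rw [hr, sub_mul, div_mul_cancel₀ _ (pow_ne_zero _ hx0)]; ring
  have hrw : ((k + 1 : ℤ) : WithTop ℤ) ≤ w r := by
    rw [hr, w.map_mul, hxk]
    calc ((k + 1 : ℤ) : WithTop ℤ) = ((0 + 1 : ℤ) : WithTop ℤ) + ((k : ℤ) : WithTop ℤ) := by
          rw [← WithTop.coe_add]; congr 1; ring
      _ ≤ _ := by gcongr; exact succ_le_of_lt' hc
  have hcw : ((0 : ℤ) : WithTop ℤ) ≤ w (algebraMap K E c) := by
    have : algebraMap K E c = z / x ^ k - (z / x ^ k - algebraMap K E c) := by ring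
    rw [this]
    exact w.map_le_sub (by rw [w_div w heq.symm hxk, sub_self]) hc.le
  have : σ z - z = algebraMap K E c * ((∑ i ∈ Finset.range k, σ x ^ i * x ^ (k - 1 - i)) * (σ x - x))
      + (σ r - r) := by
    rw [geom_sum₂_mul, hzr, map_add, map_mul, AlgEquiv.commutes, map_pow]; ring
  rw [this]
  refine w.map_le_add ?_ (hrw.trans (h.w_sub σ r))
  have h1 : ((k - 1 : ℤ) : WithTop ℤ) ≤ w (∑ i ∈ Finset.range k, σ x ^ i * x ^ (k - 1 - i)) := by
    refine w.map_le_sum fun i hi => ?_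
    rw [Finset.mem_range] at hi
    rw [w_mul w (w_pow w ((h.inv σ x).trans h.unif) i) (w_pow w h.unif _), WithTop.coe_le_coe]
    omega
  rw [w.map_mul, w.map_mul]
  calc ((k + 1 : ℤ) : WithTop ℤ) = ((0 : ℤ) : WithTop ℤ) + (((k - 1 : ℤ) : WithTop ℤ) + ((2 : ℤ) : WithTop ℤ)) := by
        rw [← WithTop.coe_add, ← WithTop.coe_add]; congr 1; ring
    _ ≤ _ := by gcongr

def OO (w : AddValuation E (WithTop ℤ)) : Subring E where
  carrier := {z | 0 ≤ w z}
  mul_mem' := by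
    intro a b ha hb
    change 0 ≤ w (a * b)
    rw [w.map_mul]; exact add_nonneg ha hb
  one_mem' := by change 0 ≤ w 1; simp
  add_mem' := by intro a b ha hb; exact w.map_le_add ha hb
  zero_mem' := by change 0 ≤ w 0; simp
  neg_mem' := by intro a ha; change 0 ≤ w (-a); rw [w.map_neg]; exact ha

theorem pos_of_pow {E : Type} [Field E] {w : AddValuation E (WithTop ℤ)} {z : E} {n : ℕ}
    (hz : 0 ≤ w z) (h : 0 < w (z ^ n)) : 0 < w z := by
  refine lt_of_le_of_ne hz fun h0 => ?_
  rw [w.map_pow, ← h0] at h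
  simp at h

theorem TR.i_wild (h : TR p K E w x) (hp : p.Prime) (σ : E ≃ₐ[K] E) (r : ℕ)
    (hr : σ ^ p ^ r = 1) : ((2 : ℤ) : WithTop ℤ) ≤ w (σ x - x) := by
  have hx0 := ne_zero_of w h.unif
  have hu : w (σ x / x) = ((0 : ℤ) : WithTop ℤ) := w_div w ((h.inv σ x).trans h.unif) h.unif
  obtain ⟨c, hc⟩ := h.approx _ hu
  set C := algebraMap K E c with hC
  have hC0 : 0 ≤ w C := by
    have : C = σ x / x - (σ x / x - C) := by ring
    rw [this]
    exact w.map_le_sub hu.ge hc.le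
  set ε := σ x - C * x with hε
  have hεw : ((2 : ℤ) : WithTop ℤ) ≤ w ε := by
    have : ε = (σ x / x - C) * x := by rw [sub_mul, div_mul_cancel₀ _ hx0]
    rw [this, w.map_mul, h.unif]
    calc ((2 : ℤ) : WithTop ℤ) = ((0 + 1 : ℤ) : WithTop ℤ) + ((1 : ℤ) : WithTop ℤ) := by
          rw [← WithTop.coe_add]; congr 1
      _ ≤ _ := by gcongr; exact succ_le_of_lt' hc
  have hm : ∀ m : ℕ, ((2 : ℤ) : WithTop ℤ) ≤ w ((σ ^ m) x - C ^ m * x) := by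
    intro m
    induction m with
    | zero => simp
    | succ m ih =>
      have : (σ ^ (m + 1)) x - C ^ (m + 1) * x = σ ((σ ^ m) x - C ^ m * x) + C ^ m * ε := by
        rw [map_sub, map_mul, map_pow, hC, AlgEquiv.commutes, ← hC, ← AlgEquiv.mul_apply, ← pow_succ', hε]
        ring
      rw [this]
      refine w.map_le_add (by rw [h.inv]; exact ih) ?_
      rw [w.map_mul, w.map_pow]
      calc ((2 : ℤ) : WithTop ℤ) = 0 + ((2 : ℤ) : WithTop ℤ) := by simp
        _ ≤ _ := by gcongr; exact nsmul_nonneg hC0 _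
  have h1 := hm (p ^ r)
  rw [hr, AlgEquiv.one_apply] at h1
  have h2 : 0 < w (1 - C ^ p ^ r) := by
    have : x - C ^ p ^ r * x = (1 - C ^ p ^ r) * x := by ring
    rw [this, w.map_mul, h.unif] at h1
    by_contra hcon
    push Not at hcon
    have : w (1 - C ^ p ^ r) + ((1 : ℤ) : WithTop ℤ) ≤ 0 + ((1 : ℤ) : WithTop ℤ) := by gcongr
    have := h1.trans this
    rw [zero_add, WithTop.coe_le_coe] at this
    omega
  have h3 : 0 < w (C - 1) := by
    let C' : OO w := ⟨C, hC0⟩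
    obtain ⟨s, hs⟩ : ∃ s : OO w, (C' - 1 + 1) ^ p ^ r = (C' - 1) ^ p ^ r + 1 ^ p ^ r + p * s := by
      obtain ⟨s, hs⟩ := exists_add_pow_prime_pow_eq hp (C' - 1) 1 r
      exact ⟨(C' - 1) * 1 * s, by rw [hs]; ring⟩
    have hs' := congrArg (OO w).subtype hs
    simp only [sub_add_cancel, one_pow, map_add, map_pow, map_sub, map_one, map_mul, map_natCast, Subring.subtype_apply] at hs'
    have h4 : (C - 1) ^ p ^ r = - (1 - C ^ p ^ r) - p * (s : E) := by
      have : (C' : E) = C := rfl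
      rw [this] at hs'
      linear_combination -hs'
    refine pos_of_pow (n := p ^ r) (w.map_le_sub hC0 (by simp)) ?_
    rw [h4]
    have h5 : 0 < w ((p : E) * s) := by
      rw [w.map_mul]
      have : 0 ≤ w (s : E) := s.2
      exact add_pos_of_pos_of_nonneg h.hp this
    rw [sub_eq_add_neg]
    exact w.map_lt_add (by rwa [w.map_neg]) (by rwa [w.map_neg])
  have h4 : σ x - x = (C - 1) * x + ε := by rw [hε]; ring
  rw [h4]
  refine w.map_le_add ?_ hεw
  rw [w.map_mul, h.unif]
  calc ((2 : ℤ) : WithTop ℤ) = ((0 + 1 : ℤ) : WithTop ℤ) + ((1 : ℤ) : WithTop ℤ) := by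
          rw [← WithTop.coe_add]; congr 1
      _ ≤ _ := by gcongr; exact succ_le_of_lt' h3

theorem TR.tame (h : TR p K E w x) (hp : p.Prime) (σ : E ≃ₐ[K] E)
    (hσ : ((2 : ℤ) : WithTop ℤ) ≤ w (σ x - x)) (m : ℕ) (hm : ¬ p ∣ m) (hs : σ ^ m = 1) : σ x = x := by
  by_contra hne
  set ε := σ x - x with hε
  obtain ⟨b, hb⟩ := exists_int w (sub_ne_zero.2 hne)
  rw [← hε] at hb
  rw [hb, WithTop.coe_le_coe] at hσ
  obtain ⟨b', rfl⟩ := Int.eq_ofNat_of_zero_le (by omega : 0 ≤ b)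
  have hw := h.wild_le σ (by rw [← hε, hb, WithTop.coe_le_coe]; exact hσ) ε b' hb.ge
  have key : ∀ k : ℕ, ((b' + 1 : ℤ) : WithTop ℤ) ≤ w ((σ ^ k) x - x - k * ε) := by
    intro k
    induction k with
    | zero => simp
    | succ k ih =>
      have : (σ ^ (k + 1)) x - x - ((k + 1 : ℕ) : E) * ε = σ ((σ ^ k) x - x - k * ε) + k * (σ ε - ε) := by
        rw [map_sub, map_sub, map_mul, map_natCast, ← AlgEquiv.mul_apply, ← pow_succ']
        push_cast
        have : σ x = x + ε := by rw [hε]; ring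
        rw [this]; ring
      rw [this]
      refine w.map_le_add (by rw [h.inv]; exact ih) ?_
      rw [w.map_mul]
      have h0 : 0 ≤ w (k : E) := (natCast_mem (OO w) k)
      calc _ = 0 + ((b' + 1 : ℤ) : WithTop ℤ) := by simp
        _ ≤ _ := by gcongr
  have h1 := key m
  rw [hs, AlgEquiv.one_apply, sub_self, zero_sub, w.map_neg] at h1
  -- multiply by inverse of m mod p
  have hcop : IsCoprime (m : ℤ) (p : ℤ) := by
    rw [Nat.isCoprime_iff_coprime]; exact ((Nat.Prime.coprime_iff_not_dvd hp).2 hm).symm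
  obtain ⟨a, c, hac⟩ := hcop
  have hac' : (a : E) * m + c * p = 1 := by exact_mod_cast congrArg (Int.cast : ℤ → E) hac
  have h2 : ε = a * (m * ε) + c * (p * ε) := by linear_combination (-ε) * hac'
  have hi : ∀ a : ℤ, 0 ≤ w (a : E) := fun a => intCast_mem (OO w) a
  have h3 : ((b' + 1 : ℤ) : WithTop ℤ) ≤ w ε := by
    rw [h2]
    refine w.map_le_add ?_ ?_
    · rw [w.map_mul]
      calc _ = 0 + ((b' + 1 : ℤ) : WithTop ℤ) := by simp
        _ ≤ _ := by gcongr; exact hi a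
    · rw [w.map_mul, w.map_mul, hb]
      calc _ = 0 + (((0 + 1 : ℤ) : WithTop ℤ) + ((b' : ℤ) : WithTop ℤ)) := by 
            rw [← WithTop.coe_zero, ← WithTop.coe_add, ← WithTop.coe_add]; congr 1; ring
        _ ≤ _ := by gcongr; exact hi c; exact succ_le_of_lt' h.hp
  rw [hb, WithTop.coe_le_coe] at h3
  omega

theorem TR.expand (h : TR p K E w x) (X : ℕ → E) (hX : ∀ k, w (X k) = ((k : ℤ) : WithTop ℤ))
    (z : E) (m : ℕ) (hz : ((m : ℤ) : WithTop ℤ) ≤ w z) (N : ℕ) :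
    ∃ c : ℕ → K, (∀ k, c k = 0 ∨ w (algebraMap K E (c k)) = ((0 : ℤ) : WithTop ℤ)) ∧
      ((m + N : ℤ) : WithTop ℤ) ≤ w (z - ∑ k ∈ Finset.Ico m (m + N), algebraMap K E (c k) * X k) := by
  classical
  induction N with
  | zero => exact ⟨0, fun k => Or.inl rfl, by simpa using hz⟩
  | succ N ih =>
    obtain ⟨c, hc, hcw⟩ := ih
    have hsplit : ∀ d : K, z - ∑ k ∈ Finset.Ico m (m + (N + 1)), 
        algebraMap K E (Function.update c (m + N) d k) * X k =
        (z - ∑ k ∈ Finset.Ico m (m + N), algebraMap K E (c k) * X k) - algebraMap K E d * X (m + N) := by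
      intro d
      rw [← add_assoc, Finset.sum_Ico_succ_top (by omega), Function.update_self, ← sub_sub]
      congr 2
      refine Finset.sum_congr rfl fun k hk => ?_
      rw [Finset.mem_Ico] at hk
      rw [Function.update_of_ne (by omega)]
    set z' := z - ∑ k ∈ Finset.Ico m (m + N), algebraMap K E (c k) * X k with hz'
    have hupd : ∀ d : K, (d = 0 ∨ w (algebraMap K E d) = ((0 : ℤ) : WithTop ℤ)) →
        ∀ k, Function.update c (m + N) d k = 0 ∨ w (algebraMap K E (Function.update c (m + N) d k)) = ((0 : ℤ) : WithTop ℤ) := by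
      intro d hd k
      by_cases hk : k = m + N
      · subst hk; rw [Function.update_self]; exact hd
      · rw [Function.update_of_ne hk]; exact hc k
    rcases hcw.lt_or_eq with hlt | heq
    · refine ⟨Function.update c (m + N) 0, hupd 0 (Or.inl rfl), ?_⟩
      rw [hsplit, map_zero, zero_mul, sub_zero]
      have := succ_le_of_lt' hlt
      convert this using 2
      push_cast; ring
    · have hXm : w (X (m + N)) = ((m + N : ℤ) : WithTop ℤ) := by rw [hX]; norm_cast
      have h0 := w_div w heq.symm hXm
      rw [sub_self] at h0
      obtain ⟨d, hd⟩ := h.approx (z' / X (m + N)) h0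
      have hdw : w (algebraMap K E d) = ((0 : ℤ) : WithTop ℤ) := by
        rw [← h0]
        apply w.map_eq_of_lt_sub
        rw [h0, w.map_sub_swap]; exact hd
      refine ⟨Function.update c (m + N) d, hupd d (Or.inr hdw), ?_⟩
      rw [hsplit]
      have h1 : z' - algebraMap K E d * X (m + N) = (z' / X (m + N) - algebraMap K E d) * X (m + N) := by
        rw [sub_mul, div_mul_cancel₀ _ (ne_zero_of w hXm)]
      rw [h1, w.map_mul, hXm]
      calc ((m + (N + 1 : ℕ) : ℤ) : WithTop ℤ) = ((0 + 1 : ℤ) : WithTop ℤ) + ((m + N : ℤ) : WithTop ℤ) := by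
            rw [← WithTop.coe_add]; congr 1; push_cast; ring
        _ ≤ _ := by gcongr; exact succ_le_of_lt' hd

end
end HA

namespace HA

section
variable {p : ℕ} {K E : Type} [Field K] [Field E] [Algebra K E]
    {w : AddValuation E (WithTop ℤ)} {x : E}

theorem TR.sen (h : TR p K E w x) (hp : p.Prime) (n : ℕ) : ∀ (σ : E ≃ₐ[K] E) (r : ℕ),
    σ ^ p ^ r = 1 → ∀ a b : ℤ, w ((σ ^ p ^ n) x - x) = (a : WithTop ℤ) →
    w ((σ ^ p ^ (n + 1)) x - x) = (b : WithTop ℤ) → (p ^ (n + 1) : ℤ) ∣ b - a := by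
  classical
  induction n using Nat.strong_induction_on with
  | _ n ih =>
  intro σ r hr a b ha hb
  by_contra hnd
  have hp0 : 0 < p := hp.pos
  -- finiteness
  have hfin : ∀ j, j ≤ n + 1 → ∃ k : ℤ, w ((σ ^ p ^ j) x - x) = (k : WithTop ℤ) := by
    intro j hj
    apply exists_int
    intro h0
    have : w ((σ ^ p ^ j) x - x) ≤ w ((σ ^ p ^ (n + 1)) x - x) := by
      have h1 : σ ^ p ^ (n + 1) = (σ ^ p ^ j) ^ p ^ (n + 1 - j) := by
        rw [← pow_mul, ← pow_add]; congr 2; omega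
      rw [h1]; exact h.i_pow _ _
    rw [h0, hb] at this
    simp at this
  choose! α hα using hfin
  have hαn : α n = a := by
    have := hα n (by omega); rw [ha] at this; exact_mod_cast this.symm
  have hαN : α (n + 1) = b := by
    have := hα (n + 1) le_rfl; rw [hb] at this; exact_mod_cast this.symm
  have hstep : ∀ j, j < n → (p ^ (j + 1) : ℤ) ∣ α (j + 1) - α j := fun j hj =>
    ih j hj σ r hr _ _ (hα j (by omega)) (hα (j + 1) (by omega))
  have hcong : ∀ v v', v ≤ v' → v' ≤ n → (p ^ (v + 1) : ℤ) ∣ α v' - α v := by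
    intro v v' hvv
    induction v', hvv using Nat.le_induction with
    | base => intro _; simp
    | succ v' hv ih2 =>
      intro hle
      have h1 := ih2 (by omega)
      have h2 := (pow_dvd_pow (p : ℤ) (by omega : v + 1 ≤ v' + 1)).trans (hstep v' (by omega))
      have := dvd_add h2 h1
      rwa [sub_add_sub_cancel] at this
  have hpn : (p ^ n : ℤ) ∣ b - a := by
    rcases Nat.eq_zero_or_pos n with rfl | hn
    · simp
    obtain ⟨n', rfl⟩ : ∃ n', n = n' + 1 := ⟨n - 1, by omega⟩
    refine ih n' (by omega) (σ ^ p) r (by rw [← pow_mul, mul_comm, pow_mul, hr, one_pow]) a b ?_ ?_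
    · rw [← pow_mul, ← pow_succ', ha]
    · rw [← pow_mul, ← pow_succ', hb]
  -- value of i on powers
  have hval : ∀ j k', j ≤ n + 1 → ¬ p ∣ k' → w ((σ ^ (p ^ j * k')) x - x) = (α j : WithTop ℤ) := by
    intro j k' hj hk
    rw [h.i_pow_coprime hp σ r hr j k' hk, hα j hj]
  have hN0 : (0 : ℤ) < (p : ℤ) ^ (n + 1) := by positivity
  obtain ⟨m, hm⟩ := Int.eq_ofNat_of_zero_le (Int.emod_nonneg (a - b) hN0.ne')
  have hmd : ((p : ℤ) ^ (n + 1)) ∣ (m : ℤ) + b - a := by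
    have h1 := Int.mul_ediv_add_emod (a - b) ((p : ℤ) ^ (n + 1))
    rw [hm] at h1
    exact ⟨-((a - b) / (p : ℤ) ^ (n + 1)), by linarith⟩
  have hmn : ¬ ((p : ℤ) ^ (n + 1)) ∣ (m : ℤ) := by
    intro hd
    apply hnd
    have := dvd_sub hmd hd
    have e : (m : ℤ) + b - a - m = b - a := by ring
    rwa [e] at this
  have hmn' : ((p : ℤ) ^ n) ∣ (m : ℤ) := by
    have h1 := (pow_dvd_pow (p : ℤ) (by omega : n ≤ n + 1)).trans hmd
    have := dvd_sub h1 hpn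
    have e : (m : ℤ) + b - a - (b - a) = m := by ring
    rwa [e] at this
  obtain ⟨k', hk'⟩ : p ^ n ∣ m := by exact_mod_cast hmn'
  have hk'p : ¬ p ∣ k' := by
    rintro ⟨l, rfl⟩
    apply hmn
    refine ⟨l, ?_⟩
    rw [hk']; push_cast; ring
  set X := XX (σ ^ p) x m with hX
  have hXw : w X = ((m : ℤ) : WithTop ℤ) := h.XX_w _ _
  have hD : w ((σ ^ p) X - X) = ((m - 1 + b : ℤ) : WithTop ℤ) := by
    rw [hX, h.XX_sub, ← pow_mul]
    have : p * m = p ^ (n + 1) * k' := by rw [hk']; ring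
    rw [this, hval (n + 1) k' le_rfl hk'p, hαN, ← WithTop.coe_add]
  set z := ∑ i ∈ Finset.range p, (σ ^ i) X with hz
  have hσz : σ z - z = (σ ^ p) X - X := by
    rw [hz, map_sum, ← Finset.sum_sub_distrib]
    have : ∀ i ∈ Finset.range p, σ ((σ ^ i) X) - (σ ^ i) X = (σ ^ (i + 1)) X - (σ ^ i) X := by
      intro i _; rw [pow_succ', AlgEquiv.mul_apply]
    rw [Finset.sum_congr rfl this, Finset.sum_range_sub (fun i => (σ ^ i) X)]
    simp
  have hwild := h.i_wild hp σ r hr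
  have hzw : (((m + 1 : ℕ) : ℤ) : WithTop ℤ) ≤ w z := by
    have : z = p * X + ∑ i ∈ Finset.range p, ((σ ^ i) X - X) := by
      rw [Finset.sum_sub_distrib, hz]; simp
    rw [this]
    refine w.map_le_add ?_ (w.map_le_sum fun i _ => ?_)
    · rw [w.map_mul, hXw]
      calc (((m + 1 : ℕ) : ℤ) : WithTop ℤ) = ((0 + 1 : ℤ) : WithTop ℤ) + ((m : ℤ) : WithTop ℤ) := by
            rw [← WithTop.coe_add]; congr 1; push_cast; ring
        _ ≤ _ := by gcongr; exact succ_le_of_lt' h.hp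
    · exact_mod_cast h.wild_le (σ ^ i) (hwild.trans (h.i_pow _ _)) X m hXw.ge
  set Nn := (m + b).toNat with hNn
  obtain ⟨c, hc, hcw⟩ := h.expand (XX σ x) (h.XX_w σ) z (m + 1) hzw Nn
  set R := z - ∑ k ∈ Finset.Ico (m + 1) (m + 1 + Nn), algebraMap K E (c k) * XX σ x k with hR
  set T : ℕ → E := fun k => algebraMap K E (c k) * (σ (XX σ x k) - XX σ x k) with hT
  set I := Finset.Ico (m + 1) (m + 1 + Nn) with hI
  have hsum : σ z - z = ∑ k ∈ I.filter (fun k => ¬ p ^ (n + 1) ∣ k), T k +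
      (∑ k ∈ I.filter (fun k => p ^ (n + 1) ∣ k), T k + (σ R - R)) := by
    have h1 : z = ∑ k ∈ I, algebraMap K E (c k) * XX σ x k + R := by rw [hR]; ring
    have h2 : σ z - z = ∑ k ∈ I, T k + (σ R - R) := by
      conv_lhs => rw [h1]
      rw [map_add, map_sum, hT]
      simp only [map_mul, AlgEquiv.commutes, mul_sub, Finset.sum_sub_distrib]
      ring
    rw [h2, ← Finset.sum_filter_add_sum_filter_not I (fun k => p ^ (n + 1) ∣ k)]
    ring
  have hrest : ((m - 1 + b : ℤ) : WithTop ℤ) <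
      w (∑ k ∈ I.filter (fun k => p ^ (n + 1) ∣ k), T k + (σ R - R)) := by
    refine w.map_lt_add ?_ ?_
    · refine w.map_lt_sum' (WithTop.coe_lt_top _) fun k hk => ?_
      rw [Finset.mem_filter, hI, Finset.mem_Ico] at hk
      obtain ⟨⟨hk1, hk2⟩, l, hl⟩ := hk
      have h1 : (b : WithTop ℤ) ≤ w ((σ ^ k) x - x) := by
        rw [hl, pow_mul, ← hb]; exact h.i_pow _ _
      rw [hT]
      simp only
      rw [w.map_mul, h.XX_sub]
      have hc0 : ((0 : ℤ) : WithTop ℤ) ≤ w (algebraMap K E (c k)) := by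
        rcases hc k with h0 | h0
        · simp [h0]
        · exact h0.ge
      calc ((m - 1 + b : ℤ) : WithTop ℤ) < ((0 : ℤ) : WithTop ℤ) + (((k - 1 : ℤ) : WithTop ℤ) + (b : WithTop ℤ)) := by
            rw [← WithTop.coe_add, ← WithTop.coe_add, WithTop.coe_lt_coe]; omega
        _ ≤ _ := by gcongr
    · refine lt_of_lt_of_le ?_ (hcw.trans (h.w_sub σ R))
      rw [WithTop.coe_lt_coe]; omega
  set S := I.filter (fun k => ¬ p ^ (n + 1) ∣ k) with hS
  have hSw : w (∑ k ∈ S, T k) = ((m - 1 + b : ℤ) : WithTop ℤ) := by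
    rw [← hD, ← hσz]
    apply w.map_eq_of_lt_sub
    rw [hsum, w.map_sub_swap, add_sub_cancel_left, ← hsum, hσz, hD]
    exact hrest
  -- decomposition of k in S
  have hdec : ∀ k ∈ S, ∃ v k', v ≤ n ∧ k = p ^ v * k' ∧ ¬ p ∣ k' := by
    intro k hk
    rw [hS, Finset.mem_filter, hI, Finset.mem_Ico] at hk
    obtain ⟨v, k', hk', hkk⟩ := Nat.exists_eq_pow_mul_and_not_dvd (n := k) (by omega) p hp.ne_one
    refine ⟨v, k', ?_, hkk, hk'⟩
    by_contra hcon
    apply hk.2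
    rw [hkk]
    exact (pow_dvd_pow p (by omega)).trans (dvd_mul_right _ _)
  have hTw : ∀ k v k', c k ≠ 0 → v ≤ n → k = p ^ v * k' → ¬ p ∣ k' → 
      w (T k) = ((k - 1 + α v : ℤ) : WithTop ℤ) := by
    intro k v k' hck hv hk hk'
    rw [hT]
    simp only
    rw [w.map_mul, h.XX_sub, (hc k).resolve_left hck]
    conv_lhs => rw [hk]
    rw [hval v k' (by omega) hk', ← hk, ← WithTop.coe_add, ← WithTop.coe_add, zero_add]
  have hnot : ∀ k v k' : ℕ, k = p ^ v * k' → ¬ p ∣ k' → ¬ ((p : ℤ) ^ (v + 1)) ∣ (k : ℤ) := by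
    intro k v k' hk hk' hd
    have hd' : p ^ (v + 1) ∣ k := by exact_mod_cast hd
    rw [hk, pow_succ] at hd'
    exact hk' (Nat.dvd_of_mul_dvd_mul_left (by positivity) hd')
  have hdist : ∀ k v k' l v' l', v ≤ v' → v' ≤ n → k = p ^ v * k' → ¬ p ∣ k' → l = p ^ v' * l' → 
      ¬ p ∣ l' → (k - 1 + α v : ℤ) = l - 1 + α v' → k = l := by
    intro k v k' l v' l' hvv hv'n hk hk' hl hl' heq
    rcases hvv.eq_or_lt with rfl | hlt
    · omega
    · exfalso
      apply hnot k v k' hk hk'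
      have h1 : ((p : ℤ) ^ (v + 1)) ∣ (l : ℤ) := by
        rw [hl]; push_cast
        exact (pow_dvd_pow _ (by omega)).trans (dvd_mul_right _ _)
      have h2 := hcong v v' hvv hv'n
      have : (k : ℤ) = l + (α v' - α v) := by linarith
      rw [this]; exact dvd_add h1 h2
  rw [sum_distinct w S T ?_] at hSw
  · rcases S.eq_empty_or_nonempty with h0 | hne
    · rw [h0, Finset.inf_empty] at hSw; exact absurd hSw WithTop.top_ne_coe
    obtain ⟨k, hk, hke⟩ := Finset.exists_mem_eq_inf S hne (fun k => w (T k))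
    rw [hke] at hSw
    obtain ⟨v, k', hv, hkk, hk'⟩ := hdec k hk
    have hck : c k ≠ 0 := by
      intro h0
      have h1 : w (T k) = ⊤ := by simp [hT, h0]
      exact absurd (h1.symm.trans hSw) WithTop.top_ne_coe
    rw [hTw k v k' hck hv hkk hk', WithTop.coe_inj] at hSw
    apply hnot k v k' hkk hk'
    have h1 := (pow_dvd_pow (p : ℤ) (by omega : v + 1 ≤ n + 1)).trans hmd
    have h2 := hcong v n hv le_rfl
    have : (k : ℤ) = (m + b - a) + (α n - α v) := by rw [hαn]; linarith
    rw [this]; exact dvd_add h1 h2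
  · intro k hk l hl hkl hTk heq
    have hck : c k ≠ 0 := by
      intro h0
      simp [hT, h0] at hTk
    have hcl : c l ≠ 0 := by
      intro h0
      have : T l = 0 := by simp [hT, h0]
      rw [this, w.map_zero, w.top_iff] at heq
      exact hTk heq
    obtain ⟨v, k', hv, hkk, hk'⟩ := hdec k hk
    obtain ⟨v', l', hv', hll, hl'⟩ := hdec l hl
    rw [hTw k v k' hck hv hkk hk', hTw l v' l' hcl hv' hll hl', WithTop.coe_inj] at heq
    rcases le_total v v' with hvv | hvv
    · exact hkl (hdist k v k' l v' l' hvv hv' hkk hk' hll hl' heq)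
    · exact hkl (hdist l v' l' k v k' hvv hv hll hl' hkk hk' heq.symm).symm

end
end HA

namespace HA

theorem cyc_sum (p : ℕ) (hp : p.Prime) (r : ℕ) (a : ℕ → ℤ)
    (ha : ∀ j, j < r → (p ^ (j + 1) : ℤ) ∣ a (j + 1) - a j) (F : ℕ → ℤ)
    (hF : ∀ k, k < p ^ (r + 1) →
      F k = a 0 + ∑ j ∈ Finset.range r, if p ^ (j + 1) ∣ k then a (j + 1) - a j else 0) :
    (p ^ (r + 1) : ℤ) ∣ ∑ k ∈ Finset.range (p ^ (r + 1)), F k := by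
  rw [Finset.sum_congr rfl (fun k hk => hF k (Finset.mem_range.1 hk)), Finset.sum_add_distrib,
    Finset.sum_comm]
  refine dvd_add (by simp) (Finset.dvd_sum fun j hj => ?_)
  rw [Finset.mem_range] at hj
  rw [← Finset.sum_filter, Finset.sum_const, nsmul_eq_mul]
  have hc : ((Finset.range (p ^ (r + 1))).filter (fun k => p ^ (j + 1) ∣ k)).card = p ^ (r - j) := by
    have he : (Finset.range (p ^ (r + 1))).filter (fun k => p ^ (j + 1) ∣ k) =
        (Finset.range (p ^ (r - j))).image (fun k => p ^ (j + 1) * k) := by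
      ext k
      have hq : p ^ (r + 1) = p ^ (j + 1) * p ^ (r - j) := by rw [← pow_add]; congr 1; omega
      have h0 : 0 < p ^ (j + 1) := pow_pos hp.pos _
      simp only [Finset.mem_filter, Finset.mem_range, Finset.mem_image]
      constructor
      · rintro ⟨h1, c, rfl⟩
        rw [hq] at h1
        exact ⟨c, lt_of_mul_lt_mul_left h1 h0.le, rfl⟩
      · rintro ⟨c, hc, rfl⟩
        rw [hq]
        exact ⟨Nat.mul_lt_mul_of_pos_left hc h0, dvd_mul_right _ _⟩
    rw [he, Finset.card_image_of_injective, Finset.card_range]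
    intro x y hxy
    exact Nat.eq_of_mul_eq_mul_left (pow_pos hp.pos _) hxy
  rw [hc]
  have : (p ^ (r + 1) : ℤ) = ((p ^ (r - j) : ℕ) : ℤ) * (p ^ (j + 1) : ℤ) := by
    push_cast; rw [← pow_add]; congr 1; omega
  rw [this]
  exact mul_dvd_mul_left _ (ha j hj)

theorem exists_char_sub {G : Type} [CommGroup G] [Finite G] (p : ℕ) (hp : p.Prime) (J : Subgroup G)
    (s : G) (hs : s ∉ J) (r : ℕ) (hr : s ^ p ^ r = 1) :
    ∃ N : Subgroup G, J ≤ N ∧ s ∉ N ∧ ∃ (g : G) (k : ℕ), g ^ p ^ k ∈ N ∧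
      ∀ y : G, ∃ m : ℕ, y * (g ^ m)⁻¹ ∈ N := by
  have hs' : (QuotientGroup.mk s : G ⧸ J) ≠ 1 := by
    rwa [Ne, QuotientGroup.eq_one_iff]
  obtain ⟨φ, hφ⟩ := CommGroup.exists_apply_ne_one_of_hasEnoughRootsOfUnity (G ⧸ J) ℂ hs'
  set ψ : G →* ℂˣ := φ.comp (QuotientGroup.mk' J) with hψ
  have hψs : ψ s ≠ 1 := hφ
  obtain ⟨k, m, hm, hq⟩ := Nat.exists_eq_pow_mul_and_not_dvd (Nat.card_pos (α := G)).ne' p hp.ne_one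
  set χ : G →* ℂˣ := ψ ^ m with hχ
  have hχa : ∀ y, χ y = ψ y ^ m := fun y => rfl
  refine ⟨χ.ker, ?_, ?_, ?_⟩
  · intro y hy
    rw [MonoidHom.mem_ker, hχa]
    have : ψ y = 1 := by
      rw [hψ, MonoidHom.comp_apply]
      have : QuotientGroup.mk' J y = 1 := by simpa using hy
      rw [this, map_one]
    rw [this, one_pow]
  · rw [MonoidHom.mem_ker, hχa]
    intro h1
    have h2 : ψ s ^ p ^ r = 1 := by rw [← map_pow, hr, map_one]
    have h3 := orderOf_dvd_of_pow_eq_one h1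
    have h4 := orderOf_dvd_of_pow_eq_one h2
    have h5 : Nat.Coprime m (p ^ r) := (Nat.Coprime.pow_left r ((Nat.Prime.coprime_iff_not_dvd hp).2 hm)).symm
    exact hψs (orderOf_eq_one_iff.1 (Nat.eq_one_of_dvd_coprimes h5 h3 h4))
  · have : Finite χ.range := Finite.of_surjective χ.rangeRestrict χ.rangeRestrict_surjective
    obtain ⟨⟨_, g, rfl⟩, hg⟩ := (inferInstance : IsCyclic χ.range).exists_generator
    refine ⟨g, k, ?_, ?_⟩
    · rw [MonoidHom.mem_ker, hχa, ← map_pow, ← pow_mul, ← hq, pow_card_eq_one', map_one]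
    · intro y
      have h1 := hg ⟨χ y, y, rfl⟩
      rw [← mem_powers_iff_mem_zpowers] at h1
      obtain ⟨m', hm'⟩ := h1
      refine ⟨m', ?_⟩
      have h2 : χ g ^ m' = χ y := congrArg Subtype.val hm'
      rw [MonoidHom.mem_ker, map_mul, map_inv, map_pow, h2, mul_inv_cancel]

section
variable {p : ℕ} {K E : Type} [Field K] [Field E] [Algebra K E]
    {w : AddValuation E (WithTop ℤ)} {x : E}

theorem TR.cyc [FiniteDimensional K E] [IsGalois K E] (h : TR p K E w x) (hp : p.Prime)
    (σ : E ≃ₐ[K] E) (hgen : ∀ τ, τ ∈ Subgroup.zpowers σ) (r : ℕ) (hord : orderOf σ = p ^ (r + 1))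
    (f : (E ≃ₐ[K] E) → ℤ) (hf : ∀ τ, τ ≠ 1 → w (τ x - x) = (f τ : WithTop ℤ))
    (hmax : ∀ τ, τ ≠ 1 → f τ ≤ f 1) (s : E ≃ₐ[K] E) (hs : s ≠ 1) (hfs : f s = f 1) :
    (p ^ (r + 1) : ℤ) ∣ ∑ τ, f τ := by
  classical
  have hsum : ∑ τ, f τ = ∑ k ∈ Finset.range (p ^ (r + 1)), f (σ ^ k) := by
    rw [← IsCyclic.image_range_orderOf hgen, Finset.sum_image, hord]
    intro a ha b hb hab
    rw [Finset.mem_coe, Finset.mem_range] at ha hb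
    exact pow_injOn_Iio_orderOf ha hb hab
  rw [hsum]
  have hr1 : σ ^ p ^ (r + 1) = 1 := by rw [← hord]; exact pow_orderOf_eq_one σ
  have hne : ∀ k, 0 < k → k < p ^ (r + 1) → σ ^ k ≠ 1 := by
    intro k h0 hk
    exact pow_ne_one_of_lt_orderOf h0.ne' (by rwa [hord])
  have hpj : ∀ j, j ≤ r → σ ^ p ^ j ≠ 1 := fun j hj =>
    hne _ (pow_pos hp.pos _) (Nat.pow_lt_pow_right hp.one_lt (by omega))
  have hval : ∀ j k, j ≤ r → ¬ p ∣ k → σ ^ (p ^ j * k) ≠ 1 → f (σ ^ (p ^ j * k)) = f (σ ^ p ^ j) := by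
    intro j k hj hk hn
    have := h.i_pow_coprime hp σ (r + 1) hr1 j k hk
    rw [hf _ hn, hf _ (hpj j hj), WithTop.coe_inj] at this
    exact this
  have hdec : ∀ k, 0 < k → k < p ^ (r + 1) → ∃ v k', v ≤ r ∧ ¬ p ∣ k' ∧ k = p ^ v * k' := by
    intro k h0 hk
    obtain ⟨v, k', hk', he⟩ := Nat.exists_eq_pow_mul_and_not_dvd h0.ne' p hp.ne_one
    refine ⟨v, k', ?_, hk', he⟩
    by_contra hv
    have h1 : p ^ (r + 1) ∣ k := he ▸ (pow_dvd_pow p (by omega)).trans (dvd_mul_right _ _)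
    exact absurd (Nat.le_of_dvd h0 h1) (by omega)
  have hmono : ∀ v, v ≤ r → f (σ ^ p ^ v) ≤ f (σ ^ p ^ r) := by
    intro v hv
    have := h.i_pow (σ ^ p ^ v) (p ^ (r - v))
    rw [← pow_mul, ← pow_add, Nat.add_sub_cancel' hv, hf _ (hpj v hv), hf _ (hpj r le_rfl),
      WithTop.coe_le_coe] at this
    exact this
  have hf1 : f 1 = f (σ ^ p ^ r) := by
    refine le_antisymm ?_ (hmax _ (hpj r le_rfl))
    rw [← hfs]
    have h1 := hgen s
    rw [← mem_powers_iff_mem_zpowers, mem_powers_iff_mem_range_orderOf, Finset.mem_image] at h1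
    obtain ⟨k, hk, rfl⟩ := h1
    rw [Finset.mem_range, hord] at hk
    have hk0 : 0 < k := by
      rcases Nat.eq_zero_or_pos k with h0 | h0
      · subst h0; simp at hs
      · exact h0
    obtain ⟨v, k', hv, hk', rfl⟩ := hdec k hk0 hk
    rw [hval v k' hv hk' hs]
    exact hmono v hv
  refine cyc_sum p hp r (fun j => f (σ ^ p ^ j)) ?_ _ ?_
  · intro j hj
    exact h.sen hp j σ (r + 1) hr1 _ _ (hf _ (hpj j (by omega))) (hf _ (hpj (j + 1) (by omega)))
  · intro k hk
    have htel : ∀ v, v ≤ r → (∀ j, j < r → (p ^ (j + 1) ∣ k ↔ j < v)) →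
        f (σ ^ p ^ 0) + ∑ j ∈ Finset.range r,
          (if p ^ (j + 1) ∣ k then f (σ ^ p ^ (j + 1)) - f (σ ^ p ^ j) else 0) = f (σ ^ p ^ v) := by
      intro v hv hiff
      have e1 : ∑ j ∈ Finset.range r,
          (if p ^ (j + 1) ∣ k then f (σ ^ p ^ (j + 1)) - f (σ ^ p ^ j) else 0) =
          ∑ j ∈ Finset.range v, (f (σ ^ p ^ (j + 1)) - f (σ ^ p ^ j)) := by
        rw [← Finset.sum_filter]
        refine Finset.sum_congr ?_ fun _ _ => rfl
        ext j
        rw [Finset.mem_filter, Finset.mem_range, Finset.mem_range]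
        constructor
        · rintro ⟨a, b⟩; exact (hiff j a).1 b
        · intro a; exact ⟨by omega, (hiff j (by omega)).2 a⟩
      rw [e1, Finset.sum_range_sub (fun j => f (σ ^ p ^ j))]
      ring
    rcases Nat.eq_zero_or_pos k with h0 | h0
    · subst h0
      rw [htel r le_rfl (fun j hj => by simp [hj]), pow_zero, hf1]
    · obtain ⟨v, k', hv, hk', rfl⟩ := hdec k h0 hk
      rw [htel v hv, hval v k' hv hk' (hne _ h0 hk)]
      intro j hj
      constructor
      · intro hd
        by_contra hvj
        have h1 : p ^ (v + 1) ∣ p ^ v * k' := (pow_dvd_pow p (by omega)).trans hd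
        rw [pow_succ] at h1
        exact hk' (Nat.dvd_of_mul_dvd_mul_left (pow_pos hp.pos _) h1)
      · intro hjv
        exact (pow_dvd_pow p (by omega)).trans (dvd_mul_right _ _)

theorem TR.quotN [FiniteDimensional K E] [IsGalois K E] (h : TR p K E w x)
    (N : Subgroup (E ≃ₐ[K] E)) [Fintype N] (M : IntermediateField K E)
    (hM : M = IntermediateField.fixedField N) [IsGalois K M] :
    ∃ (wM : AddValuation M (WithTop ℤ))
      (y : M), TR p K M wM y ∧
      (∀ z : M, w (z : E) = Nat.card N • wM z) ∧
      ∀ s : E ≃ₐ[K] E, ∑ t : N, w ((s * t) x - x) =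
        Nat.card N • wM (AlgEquiv.restrictNormalHom M s y - y) := by
  subst hM
  obtain ⟨wM, y, h1, h2, h3⟩ := h.quotient (IntermediateField.fixedField N)
  rw [IntermediateField.finrank_fixedField_eq_card] at h2 h3
  refine ⟨wM, y, h1, h2, fun s => ?_⟩
  have := h3 s
  rw [← Equiv.sum_comp (IntermediateField.subgroupEquivAlgEquiv N).toEquiv] at this
  exact this

end
end HA

namespace HA
section
variable {p : ℕ} {K E : Type} [Field K] [Field E] [Algebra K E]
    {w : AddValuation E (WithTop ℤ)} {x : E}

theorem TR.hasse_arf [FiniteDimensional K E] [IsGalois K E] (h : TR p K E w x) (hp : p.Prime)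
    (hab : ∀ σ τ : E ≃ₐ[K] E, σ * τ = τ * σ) (s : E ≃ₐ[K] E) (r : ℕ) (hr : s ^ p ^ r = 1)
    (a : ℤ) (ha : w (s x - x) = (a : WithTop ℤ))
    (f : (E ≃ₐ[K] E) → ℤ) (hf : ∀ σ, (f σ : WithTop ℤ) = min (w (σ x - x)) a) :
    (Module.finrank K E : ℤ) ∣ ∑ σ, f σ := by
  classical
  -- properties of f
  have fmul : ∀ σ τ, min (f σ) (f τ) ≤ f (σ * τ) := by
    intro σ τ
    rw [← WithTop.coe_le_coe, WithTop.coe_min, hf, hf, hf]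
    refine le_min ?_ ((min_le_left _ _).trans (min_le_right _ _))
    exact (min_le_min (min_le_left _ _) (min_le_left _ _)).trans (h.i_mul σ τ)
  have finv : ∀ σ, f σ⁻¹ = f σ := by
    intro σ
    rw [← WithTop.coe_inj, hf, hf, h.i_inv]
  have fs : f s = a := by rw [← WithTop.coe_inj, hf, ha, min_self]
  have fle : ∀ σ, f σ ≤ a := by
    intro σ; rw [← WithTop.coe_le_coe, hf]; exact min_le_right _ _
  have fst : ∀ t, f (s * t) = f t := by
    intro t
    refine le_antisymm ?_ ?_
    · have := fmul s⁻¹ (s * t)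
      rw [inv_mul_cancel_left, finv, fs, min_eq_right (fle _)] at this
      exact this
    · have := fmul s t
      rwa [fs, min_eq_right (fle _)] at this
  let J : Subgroup (E ≃ₐ[K] E) :=
    { carrier := {σ | (a : WithTop ℤ) < w (σ x - x)}
      mul_mem' := fun {σ τ} h1 h2 => lt_of_lt_of_le (lt_min h1 h2) (h.i_mul σ τ)
      one_mem' := by
        simp only [Set.mem_ofPred_eq, AlgEquiv.one_apply, sub_self, w.map_zero]
        exact WithTop.coe_lt_top a
      inv_mem' := fun {σ} h1 => by
        simp only [Set.mem_ofPred_eq] at h1 ⊢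
        rw [h.i_inv]; exact h1 }
  have hJ : ∀ σ, σ ∈ J ↔ (a : WithTop ℤ) < w (σ x - x) := fun σ => Iff.rfl
  have hsJ : s ∉ J := by rw [hJ, ha]; exact lt_irrefl _
  let _ : CommGroup (E ≃ₐ[K] E) := { (inferInstance : Group (E ≃ₐ[K] E)) with mul_comm := hab }
  obtain ⟨N, hJN, hsN, g, k, hgk, hgen⟩ := exists_char_sub p hp J s hsJ r hr
  have hfN : ∀ σ, σ ∉ N → w (σ x - x) = (f σ : WithTop ℤ) := by
    intro σ hσ
    rw [hf, min_eq_left]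
    have : σ ∉ J := fun h1 => hσ (hJN h1)
    rw [hJ] at this
    exact not_lt.1 this
  have : N.Normal := ⟨fun a ha b => by rw [mul_comm b a, mul_inv_cancel_right]; exact ha⟩
  obtain ⟨M, hM⟩ : ∃ M, M = IntermediateField.fixedField N := ⟨_, rfl⟩
  have : IsGalois K M := by rw [hM]; infer_instance
  obtain ⟨wM, y, hT, hw, hH⟩ := h.quotN N M hM
  set res := AlgEquiv.restrictNormalHom (F := K) (K₁ := E) M with hres
  have hker : ∀ σ, res σ = 1 ↔ σ ∈ N := by
    intro σ
    rw [← MonoidHom.mem_ker, hres, IntermediateField.restrictNormalHom_ker, hM,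
      IntermediateField.fixingSubgroup_fixedField]
  have hsurj : Function.Surjective res := AlgEquiv.restrictNormalHom_surjective E
  have hN0 : 0 < Nat.card N := Nat.card_pos
  have hex : ∀ c : M ≃ₐ[K] M, c ≠ 1 → ∃ b : ℤ, wM (c y - y) = (b : WithTop ℤ) := by
    intro c hc
    apply exists_int
    rw [sub_ne_zero]
    exact fun h1 => hc (hT.faithful c h1)
  choose! f0 hf0 using hex
  set f' : (M ≃ₐ[K] M) → ℤ := fun c => if c = 1 then f0 (res s) else f0 c with hf'
  have hress : res s ≠ 1 := fun h1 => hsN ((hker s).1 h1)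
  have hf'1 : f' (res s) = f' 1 := by simp [hf']
  have hf'n : ∀ c, c ≠ 1 → wM (c y - y) = (f' c : WithTop ℤ) := by
    intro c hc
    rw [hf0 c hc]; simp [hf', hc]
  have sumN : ∀ u, ∑ t : N, f (u * t) = Nat.card N * f' (res u) := by
    have key : ∀ u, u ∉ N → ∑ t : N, f (u * t) = Nat.card N * f' (res u) := by
      intro u hu
      have h1 := hH u
      have hne : res u ≠ 1 := fun h1 => hu ((hker u).1 h1)
      rw [hf'n _ hne, ← WithTop.coe_nsmul, nsmul_eq_mul,
        Finset.sum_congr rfl (fun (t : N) _ => hfN (u * (t : E ≃ₐ[K] E)) (fun h2 => hu ((N.mul_mem_cancel_right t.2).1 h2))),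
        ← WithTop.coe_sum, WithTop.coe_inj] at h1
      exact_mod_cast h1
    intro u
    by_cases hu : u ∈ N
    · have h1 := key (s * u) (fun h2 => hsN ((N.mul_mem_cancel_right hu).1 h2))
      rw [map_mul, (hker u).2 hu, mul_one, hf'1] at h1
      rw [(hker u).2 hu, ← h1]
      exact Finset.sum_congr rfl fun t _ => by rw [mul_assoc, fst]
    · exact key u hu
  have hNz : ((Nat.card N : ℕ) : ℤ) ≠ 0 := by exact_mod_cast hN0.ne'
  have tot : ∑ σ, f σ = ∑ σ, f' (res σ) := by
    apply mul_left_cancel₀ hNz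
    rw [Finset.mul_sum (s := Finset.univ) (f := fun σ => f' (res σ)), Finset.sum_congr rfl (fun u _ => (sumN u).symm), Finset.sum_comm]
    have : ∀ t : N, ∑ u, f (u * t) = ∑ u, f u := fun t =>
      Equiv.sum_comp (Equiv.mulRight (t : E ≃ₐ[K] E)) f
    rw [Finset.sum_congr rfl (fun t _ => this t), Finset.sum_const, Finset.card_univ,
      nsmul_eq_mul, Nat.card_eq_fintype_card]
  have fib : ∀ c, (Finset.univ.filter (fun σ => res σ = c)).card = Nat.card N := by
    intro c
    obtain ⟨u, rfl⟩ := hsurj c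
    rw [Nat.card_eq_fintype_card, ← Finset.card_univ]
    symm
    refine Finset.card_bij (fun t _ => u * (t : E ≃ₐ[K] E)) ?_ ?_ ?_
    · intro t _
      rw [Finset.mem_filter]
      exact ⟨Finset.mem_univ _, by rw [map_mul, (hker _).2 t.2, mul_one]⟩
    · intro t _ t' _ he
      exact Subtype.ext (mul_left_cancel he)
    · intro b hb
      rw [Finset.mem_filter] at hb
      refine ⟨⟨u⁻¹ * b, (hker _).1 (by rw [map_mul, map_inv, hb.2, inv_mul_cancel])⟩,
        Finset.mem_univ _, ?_⟩
      exact mul_inv_cancel_left u b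
  have tot2 : ∑ σ, f' (res σ) = Nat.card N * ∑ c, f' c := by
    rw [← Finset.sum_fiberwise (s := Finset.univ) (g := res) (f := fun σ => f' (res σ)), Finset.mul_sum]
    refine Finset.sum_congr rfl fun c _ => ?_
    rw [Finset.sum_congr rfl (g := fun _ => f' c) (fun σ hσ => by rw [(Finset.mem_filter.1 hσ).2]),
      Finset.sum_const, fib, nsmul_eq_mul]
  have hmax : ∀ c, c ≠ 1 → f' c ≤ f' 1 := by
    intro c hc
    obtain ⟨u0, hu0⟩ := hsurj c
    obtain ⟨u, hu, humax⟩ := Finset.exists_max_image (Finset.univ.filter (fun σ => res σ = c)) f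
      ⟨u0, by simp [hu0]⟩
    rw [Finset.mem_filter] at hu
    have h1 := sumN u
    have h2 := sumN 1
    rw [hu.2] at h1
    rw [map_one] at h2
    have h3 : ∑ t : N, f (u * t) ≤ ∑ t : N, f (1 * t) := by
      refine Finset.sum_le_sum fun t _ => ?_
      have h4 : f (u * t) ≤ f u := humax _ (by
        rw [Finset.mem_filter]
        exact ⟨Finset.mem_univ _, by rw [map_mul, (hker _).2 t.2, mul_one, hu.2]⟩)
      have h5 := fmul u⁻¹ (u * t)
      rw [inv_mul_cancel_left, finv, min_eq_right h4] at h5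
      rwa [one_mul]
    rw [h1, h2] at h3
    exact le_of_mul_le_mul_left h3 (by exact_mod_cast hN0)
  have hgen' : ∀ c, c ∈ Subgroup.zpowers (res g) := by
    intro c
    obtain ⟨u, rfl⟩ := hsurj c
    obtain ⟨m, hm⟩ := hgen u
    rw [← hker, map_mul, map_inv, map_pow, mul_inv_eq_one] at hm
    rw [hm]; exact Subgroup.npow_mem_zpowers _ _
  have hord1 : orderOf (res g) ∣ p ^ k := by
    apply orderOf_dvd_of_pow_eq_one
    rw [← map_pow]; exact (hker _).2 hgk
  obtain ⟨e, -, he⟩ := (Nat.dvd_prime_pow hp).1 hord1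
  obtain ⟨e, rfl⟩ : ∃ e', e = e' + 1 := by
    rcases e with _ | e
    · exfalso
      rw [pow_zero, orderOf_eq_one_iff] at he
      have := hgen' (res s)
      rw [he, Subgroup.zpowers_one_eq_bot, Subgroup.mem_bot] at this
      exact hress this
    · exact ⟨e, rfl⟩
  have hcyc := hT.cyc hp (res g) hgen' e he f' hf'n hmax (res s) hress hf'1
  have hcard : Module.finrank K M = p ^ (e + 1) := by
    rw [← IsGalois.card_aut_eq_finrank, ← he, orderOf_eq_card_of_forall_mem_zpowers hgen']
  have hcE : Module.finrank K E = p ^ (e + 1) * Nat.card N := by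
    rw [← hcard, ← IntermediateField.finrank_fixedField_eq_card, ← hM, Module.finrank_mul_finrank]
  rw [tot, tot2, hcE, mul_comm]
  push_cast
  exact mul_dvd_mul_left _ hcyc
end
end HA

namespace HA
section
variable {p : ℕ} {A : Type} [Field A] (vd : PadicValData A p)

theorem v_one : vd.v 1 = 0 := by
  have h := vd.v_mul 1 1
  rw [mul_one] at h
  have h1 : vd.v 1 ≠ ⊤ := by rw [Ne, vd.v_top_iff]; exact one_ne_zero
  obtain ⟨a, ha⟩ := WithTop.ne_top_iff_exists.1 h1
  rw [← ha, ← WithTop.coe_add, WithTop.coe_inj] at h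
  rw [← ha, ← WithTop.coe_zero, WithTop.coe_inj]
  linarith

/-- The additive valuation attached to the data and an embedding. -/
noncomputable def av {F : Type} [Field F] (emb : F →+* A) : AddValuation F (WithTop ℚ) :=
  AddValuation.of (fun z => vd.v (emb z)) (by simp [(vd.v_top_iff 0).2 rfl]) (by simp [v_one])
    (fun a b => by simpa using vd.v_min_le_add (emb a) (emb b))
    (fun a b => by simpa using vd.v_mul (emb a) (emb b))

theorem av_apply {F : Type} [Field F] (emb : F →+* A) (z : F) : av vd emb z = vd.v (emb z) := rfl

theorem imp_iff {F : Type} [Field F] (emb : F →+* A) (j : ℕ) (z : F) :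
    InMaxIdealPow vd emb j (emb z) ↔
      ∃ (u : F) (s : Fin j → F), 0 ≤ av vd emb u ∧ (∀ k, 0 < av vd emb (s k)) ∧ z = u * ∏ k, s k := by
  constructor
  · rintro ⟨u, s, hu, hs, h⟩
    refine ⟨u, s, hu, hs, ?_⟩
    apply emb.injective
    rw [map_mul, map_prod]; exact h
  · rintro ⟨u, s, hu, hs, h⟩
    refine ⟨u, s, hu, hs, ?_⟩
    rw [h, map_mul, map_prod]

theorem imp_succ {F : Type} [Field F] (emb : F →+* A) (j : ℕ) (y : A)
    (h : InMaxIdealPow vd emb (j + 1) y) : InMaxIdealPow vd emb j y := by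
  obtain ⟨u, s, hu, hs, h⟩ := h
  refine ⟨u * s (Fin.last j), fun k => s k.castSucc, ?_, fun k => hs _, ?_⟩
  · rw [map_mul, vd.v_mul]
    exact add_nonneg hu (hs _).le
  · rw [h, Fin.prod_univ_castSucc, map_mul]; ring

theorem imp_mono {F : Type} [Field F] (emb : F →+* A) {i j : ℕ} (hij : i ≤ j) (y : A)
    (h : InMaxIdealPow vd emb j y) : InMaxIdealPow vd emb i y := by
  induction j, hij using Nat.le_induction with
  | base => exact h
  | succ j _ ih => exact ih (imp_succ vd emb j y h)

variable (K L : Type) [Field K] [Field L] [Algebra K L] (emb : L →+* A)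

theorem low_anti : Antitone (lowerRamSet vd K L emb) := by
  intro i j hij σ hσ x hx
  exact imp_mono vd emb (by omega) _ (hσ x hx)

theorem av_p : av vd emb (p : L) = 1 := by
  rw [av_apply, map_natCast, vd.v_coe_p]

theorem one_mem_low (m : ℤ) : (1 : L ≃ₐ[K] L) ∈ lowerRamSet vd K L emb m := by
  intro x _
  have : emb ((1 : L ≃ₐ[K] L) x) - emb x = emb 0 := by simp
  rw [this, imp_iff]
  refine ⟨0, fun _ => p, ?_, fun k => ?_, by simp⟩
  · rw [AddValuation.map_zero]; exact le_top
  · rw [av_p]; exact zero_lt_one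

variable [FiniteDimensional K L]

theorem card_pos_low (m : ℤ) : 0 < Nat.card (lowerRamSet vd K L emb m) := by
  have : Nonempty (lowerRamSet vd K L emb m) := ⟨⟨1, one_mem_low vd K L emb m⟩⟩
  exact Nat.card_pos

theorem card_anti : Antitone fun m : ℤ => Nat.card (lowerRamSet vd K L emb m) := by
  intro i j hij
  exact Nat.card_mono (Set.toFinite _) (low_anti vd K L emb hij)

theorem g_anti : Antitone fun t : ℝ => (Nat.card ↥(lowerRamSet vd K L emb ⌈t⌉) : ℝ) /
      (Nat.card ↥(lowerRamSet vd K L emb 0) : ℝ) := by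
  intro a b hab
  have := card_anti vd K L emb (Int.ceil_le_ceil hab)
  simp only at this ⊢
  gcongr

theorem g_int (a b : ℝ) : IntervalIntegrable (fun t : ℝ =>
    (Nat.card ↥(lowerRamSet vd K L emb ⌈t⌉) : ℝ) /
      (Nat.card ↥(lowerRamSet vd K L emb 0) : ℝ)) MeasureTheory.volume a b :=
  (g_anti vd K L emb).intervalIntegrable

theorem phi_zero : herbrandPhi vd K L emb 0 = 0 := by simp [herbrandPhi]

theorem phi_sub (a b : ℝ) : herbrandPhi vd K L emb b - herbrandPhi vd K L emb a =
    ∫ t in a..b, (Nat.card ↥(lowerRamSet vd K L emb ⌈t⌉) : ℝ) /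
      (Nat.card ↥(lowerRamSet vd K L emb 0) : ℝ) := by
  rw [herbrandPhi, herbrandPhi]
  exact intervalIntegral.integral_interval_sub_left (g_int vd K L emb _ _) (g_int vd K L emb _ _)

theorem phi_ge (a b : ℝ) (hab : a ≤ b) :
    (b - a) * (1 / (Nat.card ↥(lowerRamSet vd K L emb 0) : ℝ)) ≤
      herbrandPhi vd K L emb b - herbrandPhi vd K L emb a := by
  rw [phi_sub]
  have : (b - a) * (1 / (Nat.card ↥(lowerRamSet vd K L emb 0) : ℝ)) =
      ∫ t in a..b, (1 / (Nat.card ↥(lowerRamSet vd K L emb 0) : ℝ)) := by simp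
  rw [this]
  refine intervalIntegral.integral_mono_on hab (by simp) (g_int vd K L emb _ _) fun t _ => ?_
  have h1 : 1 ≤ Nat.card ↥(lowerRamSet vd K L emb ⌈t⌉) := card_pos_low vd K L emb _
  gcongr
  exact_mod_cast h1

theorem phi_mono : StrictMono (herbrandPhi vd K L emb) := by
  intro a b hab
  have h := phi_ge vd K L emb a b hab.le
  have h0 : (0 : ℝ) < Nat.card ↥(lowerRamSet vd K L emb 0) := by
    exact_mod_cast card_pos_low vd K L emb 0
  have : 0 < (b - a) * (1 / (Nat.card ↥(lowerRamSet vd K L emb 0) : ℝ)) :=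
    mul_pos (by linarith) (by positivity)
  linarith

theorem phi_surj : Function.Surjective (herbrandPhi vd K L emb) := by
  have hc : Continuous (herbrandPhi vd K L emb) :=
    intervalIntegral.continuous_primitive (fun a b => g_int vd K L emb a b) 0
  have h0 : (0 : ℝ) < Nat.card ↥(lowerRamSet vd K L emb 0) := by
    exact_mod_cast card_pos_low vd K L emb 0
  set C : ℝ := ((Nat.card ↥(lowerRamSet vd K L emb 0) : ℕ) : ℝ) with hC
  intro y
  have h1 : y ≤ herbrandPhi vd K L emb (|y| * C) := by
    have := phi_ge vd K L emb 0 (|y| * C) (by positivity)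
    rw [phi_zero, sub_zero, sub_zero, ← hC, mul_one_div, mul_div_cancel_right₀ _ h0.ne'] at this
    exact (le_abs_self y).trans this
  have h2 : herbrandPhi vd K L emb (-(|y| * C)) ≤ y := by
    have := phi_ge vd K L emb (-(|y| * C)) 0 (by rw [neg_nonpos]; positivity)
    rw [phi_zero, zero_sub, zero_sub, neg_neg, ← hC, mul_one_div, mul_div_cancel_right₀ _ h0.ne'] at this
    have := neg_abs_le y
    linarith
  exact mem_range_of_exists_le_of_exists_ge hc ⟨_, h2⟩ ⟨_, h1⟩

theorem phi_psi (y : ℝ) : herbrandPhi vd K L emb (herbrandPsi vd K L emb y) = y :=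
  Function.rightInverse_invFun (phi_surj vd K L emb) y

theorem psi_phi (y : ℝ) : herbrandPsi vd K L emb (herbrandPhi vd K L emb y) = y :=
  Function.leftInverse_invFun (phi_mono vd K L emb).injective y

theorem phi_succ (m : ℤ) : herbrandPhi vd K L emb (m + 1 : ℤ) = herbrandPhi vd K L emb m +
    (Nat.card ↥(lowerRamSet vd K L emb (m + 1)) : ℝ) /
      (Nat.card ↥(lowerRamSet vd K L emb 0) : ℝ) := by
  have h := phi_sub vd K L emb (m : ℝ) ((m + 1 : ℤ) : ℝ)
  have h2 : ∫ t in (m : ℝ)..((m + 1 : ℤ) : ℝ), (Nat.card ↥(lowerRamSet vd K L emb ⌈t⌉) : ℝ) /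
      (Nat.card ↥(lowerRamSet vd K L emb 0) : ℝ) =
      ∫ t in (m : ℝ)..((m + 1 : ℤ) : ℝ), (Nat.card ↥(lowerRamSet vd K L emb (m + 1)) : ℝ) /
      (Nat.card ↥(lowerRamSet vd K L emb 0) : ℝ) := by
    refine intervalIntegral.integral_congr_ae (Filter.Eventually.of_forall fun t ht => ?_)
    rw [Set.uIoc_of_le (by push_cast; linarith), Set.mem_Ioc] at ht
    have : ⌈t⌉ = m + 1 := by
      rw [Int.ceil_eq_iff]
      refine ⟨?_, ht.2⟩
      push_cast; linarith [ht.1]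
    rw [this]
  rw [h2, intervalIntegral.integral_const] at h
  push_cast at h ⊢
  rw [add_sub_cancel_left, one_smul] at h
  linarith

theorem psi_zero : herbrandPsi vd K L emb 0 = 0 := by
  have := psi_phi vd K L emb 0
  rwa [phi_zero] at this

theorem psi_mono : StrictMono (herbrandPsi vd K L emb) := by
  intro a b hab
  rw [← (phi_mono vd K L emb).lt_iff_lt, phi_psi, phi_psi]
  exact hab

end
end HA

namespace HA
section
variable {p : ℕ} {A : Type} [Field A] (vd : PadicValData A p)

/-- `w` is the valuation of `F` rescaled by `c`. -/
structure Cmp {F : Type} [Field F] (emb : F →+* A) (w : AddValuation F (WithTop ℤ)) (c : ℚ) : Prop where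
  pos : 0 < c
  iff : ∀ (z : F) (k : ℤ), w z = (k : WithTop ℤ) ↔ av vd emb z = ((k * c : ℚ) : WithTop ℚ)

variable {vd} {F : Type} [Field F] {emb : F →+* A} {w : AddValuation F (WithTop ℤ)} {c : ℚ}

theorem Cmp.le_iff (h : Cmp vd emb w c) (z : F) : 0 ≤ av vd emb z ↔ ((0 : ℤ) : WithTop ℤ) ≤ w z := by
  by_cases hz : z = 0
  · subst hz; simp
  obtain ⟨k, hk⟩ := exists_int w hz
  rw [hk, (h.iff z k).1 hk, ← WithTop.coe_zero, WithTop.coe_le_coe, WithTop.coe_le_coe]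
  rw [mul_nonneg_iff_of_pos_right h.pos]
  exact_mod_cast Iff.rfl

theorem Cmp.lt_iff (h : Cmp vd emb w c) (z : F) : 0 < av vd emb z ↔ ((0 : ℤ) : WithTop ℤ) < w z := by
  by_cases hz : z = 0
  · subst hz; simp
  obtain ⟨k, hk⟩ := exists_int w hz
  rw [hk, (h.iff z k).1 hk, ← WithTop.coe_zero, WithTop.coe_lt_coe, WithTop.coe_lt_coe]
  rw [mul_pos_iff_of_pos_right h.pos]
  exact_mod_cast Iff.rfl

theorem Cmp.low_iff {K : Type} [Field K] [Algebra K F] [FiniteDimensional K F] [IsGalois K F] {y : F}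
    (h : Cmp vd emb w c) (hT : TR p K F w y) (u : ℕ) (σ : F ≃ₐ[K] F) :
    σ ∈ lowerRamSet vd K F emb (u : ℤ) ↔ ((u + 1 : ℤ) : WithTop ℤ) ≤ w (σ y - y) := by
  have hu : ((u : ℤ) + 1).toNat = u + 1 := by omega
  have hy0 := ne_zero_of w hT.unif
  constructor
  · intro hσ
    have h1 := hσ y (by
      rw [← av_apply, h.le_iff, hT.unif]; exact WithTop.coe_le_coe.2 zero_le_one)
    rw [hu, ← map_sub, imp_iff] at h1
    obtain ⟨v, s, hv, hs, he⟩ := h1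
    rw [he, w.map_mul, w_prod]
    rw [h.le_iff] at hv
    have h2 : ∑ k : Fin (u + 1), ((1 : ℤ) : WithTop ℤ) ≤ ∑ k, w (s k) := by
      refine Finset.sum_le_sum fun k _ => ?_
      have := (h.lt_iff _).1 (hs k)
      have := succ_le_of_lt' this
      simpa using this
    rw [Finset.sum_const, Finset.card_univ, Fintype.card_fin, ← WithTop.coe_nsmul] at h2
    have h3 := add_le_add hv h2
    rw [← WithTop.coe_add] at h3
    convert h3 using 2
    simp
  · intro hσ x hx
    rw [← av_apply, h.le_iff] at hx
    have h1 := hσ.trans (hT.le_sub σ x hx)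
    rw [hu, ← map_sub, imp_iff]
    refine ⟨(σ x - x) / y ^ (u + 1), fun _ => y, ?_, fun _ => ?_, ?_⟩
    · rw [h.le_iff]
      by_cases h0 : σ x - x = 0
      · rw [h0, zero_div, w.map_zero]; exact le_top
      obtain ⟨k, hk⟩ := exists_int w h0
      rw [hk, WithTop.coe_le_coe] at h1
      rw [w_div w hk (w_pow w hT.unif (u + 1)), WithTop.coe_le_coe]
      push_cast; linarith
    · rw [h.lt_iff, hT.unif]; exact WithTop.coe_lt_coe.2 zero_lt_one
    · rw [Finset.prod_const, Finset.card_univ, Fintype.card_fin, div_mul_cancel₀ _ (pow_ne_zero _ hy0)]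

end
end HA

namespace HA
open Polynomial
section
variable {E : Type} [Field E] (w : AddValuation E (WithTop ℤ))

/-- The maximal ideal. -/
def II : Ideal (OO w) where
  carrier := {z | 0 < w (z : E)}
  add_mem' := by intro a b ha hb; exact w.map_lt_add ha hb
  zero_mem' := by change 0 < w 0; simp
  smul_mem' := by
    intro a b hb
    change 0 < w (a * b)
    rw [w.map_mul]; exact lt_of_lt_of_le hb (le_add_of_nonneg_left a.2)

theorem mem_II (z : OO w) : z ∈ II w ↔ 0 < w (z : E) := Iff.rfl

instance : (II w).IsPrime where
  ne_top' := by
    rw [Ne, Ideal.eq_top_iff_one, mem_II]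
    simp
  mem_or_mem' := by
    intro a b hab
    rw [mem_II, Subring.coe_mul, w.map_mul] at hab
    rw [mem_II, mem_II]
    by_contra hc
    push Not at hc
    have h1 := le_antisymm hc.1 a.2
    have h2 := le_antisymm hc.2 b.2
    rw [h1, h2] at hab
    simp at hab

variable (p : ℕ) [hpp : Fact p.Prime] (θ : ℚ_[p] →+* E)

theorem exists_root (m : ℕ) (hm : ¬ p ∣ m) (a : ℤ_[p]) : ∃ b : ℤ_[p], b ^ m = 1 + p * a := by
  have h1 : ‖(m : ℤ_[p])‖ = 1 := by
    rw [PadicInt.norm_def, PadicInt.coe_natCast]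
    exact Padic.norm_natCast_eq_one_iff.2 ((Nat.Prime.coprime_iff_not_dvd hpp.out).2 hm)
  have hm0 : m ≠ 0 := by rintro rfl; simp at hm
  obtain ⟨b, hb, -⟩ := hensels_lemma (p := p) (F := (X ^ m - C (1 + (p : ℤ_[p]) * a) : ℤ_[p][X])) (a := 1) (by
    have e1 : aeval (1 : ℤ_[p]) (X ^ m - C (1 + (p : ℤ_[p]) * a)) = - ((p : ℤ_[p]) * a) := by simp
    have e2 : aeval (1 : ℤ_[p]) (derivative (X ^ m - C (1 + (p : ℤ_[p]) * a))) = (m : ℤ_[p]) := by simp [derivative_X_pow]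
    rw [e1, e2, h1, norm_neg, norm_mul]
    have h2 : ‖(p : ℤ_[p])‖ < 1 := by
      rw [PadicInt.norm_def, PadicInt.coe_natCast]; exact Padic.norm_p_lt_one
    have h3 := PadicInt.norm_le_one a
    nlinarith [norm_nonneg (p : ℤ_[p]), norm_nonneg a])
  refine ⟨b, ?_⟩
  simpa [sub_eq_zero] using hb

theorem one_add_ne (a : ℤ_[p]) : (1 + p * a : ℤ_[p]) ≠ 0 := by
  intro h
  have h2 : ‖(p : ℤ_[p]) * a‖ < 1 := by
    rw [norm_mul]
    have h2 : ‖(p : ℤ_[p])‖ < 1 := by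
      rw [PadicInt.norm_def, PadicInt.coe_natCast]; exact Padic.norm_p_lt_one
    have h3 := PadicInt.norm_le_one a
    nlinarith [norm_nonneg (p : ℤ_[p]), norm_nonneg a]
  have : (p : ℤ_[p]) * a = -1 := by linear_combination h
  rw [this] at h2
  simp at h2

theorem w_one_add (a : ℤ_[p]) : w (θ ((1 + p * a : ℤ_[p]) : ℚ_[p])) = ((0 : ℤ) : WithTop ℤ) := by
  have hne : θ ((1 + p * a : ℤ_[p]) : ℚ_[p]) ≠ 0 := by
    rw [Ne, map_eq_zero, PadicInt.coe_eq_zero]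
    exact one_add_ne p a
  obtain ⟨k, hk⟩ := exists_int w hne
  set m := p * k.natAbs + 1 with hm
  obtain ⟨b, hb⟩ := exists_root p m (by
    intro h
    rw [hm, Nat.dvd_add_right (dvd_mul_right _ _)] at h
    exact hpp.out.one_lt.ne' (Nat.dvd_one.1 h)) a
  rw [← hb, PadicInt.coe_pow, map_pow] at hk hne
  have hb0 : θ (b : ℚ_[p]) ≠ 0 := by
    intro h0; rw [h0, zero_pow (by omega)] at hne; exact hne rfl
  obtain ⟨l, hl⟩ := exists_int w hb0
  have h1 := w_pow w hl m
  rw [hk, WithTop.coe_inj] at h1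
  have h2 : k = 0 := by
    by_contra h0
    have h3 : (m : ℤ) ∣ k := ⟨l, by rw [h1]⟩
    have h4 := Nat.le_of_dvd (Int.natAbs_pos.2 h0) (Int.natCast_dvd.1 h3)
    have := hpp.out.one_lt
    nlinarith
  rw [← hb, PadicInt.coe_pow, map_pow, hk, h2]

theorem w_nonneg (a : ℤ_[p]) : 0 ≤ w (θ (a : ℚ_[p])) := by
  have hpa : ∀ a : ℤ_[p], 0 ≤ w (p * θ (a : ℚ_[p])) := by
    intro a
    have : (p : E) * θ (a : ℚ_[p]) = θ ((1 + p * a : ℤ_[p]) : ℚ_[p]) - 1 := by simp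
    rw [this]
    exact w.map_le_sub (w_one_add w p θ a).ge (by simp)
  by_cases ha : θ (a : ℚ_[p]) = 0
  · rw [ha]; simp
  have hp0 : (p : E) ≠ 0 := by
    have : (p : E) = θ p := by simp
    rw [this, Ne, map_eq_zero]
    exact_mod_cast hpp.out.ne_zero
  obtain ⟨k, hk⟩ := exists_int w ha
  obtain ⟨l, hl⟩ := exists_int w hp0
  rw [hk, ← WithTop.coe_zero, WithTop.coe_le_coe]
  by_contra hneg
  have h1 := hpa (a ^ (l.natAbs + 1))
  rw [PadicInt.coe_pow, map_pow, w_mul w hl (w_pow w hk _), ← WithTop.coe_zero, WithTop.coe_le_coe] at h1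
  push_cast at h1
  have : |l| ≥ l := le_abs_self l
  have := abs_nonneg l
  nlinarith

/-- the ring hom to the residue ring -/
noncomputable def rho : ℤ_[p] →+* OO w ⧸ II w :=
  (Ideal.Quotient.mk (II w)).comp
    ((θ.comp (PadicInt.Coe.ringHom (p := p))).codRestrict (OO w) (fun a => w_nonneg w p θ a))

theorem char_res (hp : 0 < w (p : E)) : CharP (OO w ⧸ II w) p := by
  have : ((p : ℕ) : OO w ⧸ II w) = 0 := by
    rw [← map_natCast (Ideal.Quotient.mk (II w)), Ideal.Quotient.eq_zero_iff_mem, mem_II]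
    simpa using hp
  obtain ⟨q, hq⟩ := CharP.exists (OO w ⧸ II w)
  have h2 := (CharP.cast_eq_zero_iff (OO w ⧸ II w) q p).1 this
  rcases (Nat.dvd_prime hpp.out).1 h2 with h | h
  · subst h; exact absurd rfl (CharP.char_ne_one (OO w ⧸ II w) 1)
  · subst h; exact hq

end
end HA

namespace HA
open Polynomial
section
variable {E : Type} [Field E] (w : AddValuation E (WithTop ℤ))
variable (p : ℕ) [hpp : Fact p.Prime] (θ : ℚ_[p] →+* E)

theorem frob_per {R : Type} [CommRing R] [IsDomain R] [CharP R p] (ρ : ℤ_[p] →+* R) (z : R)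
    (g : ℤ_[p][X]) (k : ℕ) (hk : g.coeff k = 1) (hg : g.eval₂ ρ z = 0) :
    ∃ m : ℕ, 1 ≤ m ∧ z ^ p ^ m = z := by
  let _ := ZMod.algebra R p
  have hρ : ρ = (algebraMap (ZMod p) R).comp (PadicInt.toZMod (p := p)) := by
    ext a
    have h1 := PadicInt.toZMod_spec a
    rw [PadicInt.maximalIdeal_eq_span_p, Ideal.mem_span_singleton] at h1
    obtain ⟨b, hb⟩ := h1
    have h2 : a = ((PadicInt.toZMod a).val : ℕ) + p * b := by
      rw [← hb, ZMod.natCast_val]; ring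
    have h3 : ρ a = ((PadicInt.toZMod a).val : ℕ) := by
      conv_lhs => rw [h2]
      simp
    rw [h3, RingHom.comp_apply, ← map_natCast (algebraMap (ZMod p) R), ZMod.natCast_val, ZMod.cast_id]
  have hint : IsIntegral (ZMod p) z := by
    rw [← isAlgebraic_iff_isIntegral]
    refine ⟨g.map PadicInt.toZMod, ?_, ?_⟩
    · intro h0
      have := congrArg (fun q => q.coeff k) h0
      simp [hk] at this
    · rw [aeval_def, eval₂_map, ← hρ, hg]
  have hfin : Module.Finite (ZMod p) (Algebra.adjoin (ZMod p) {z}) := by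
    exact Module.Finite.iff_fg.2 hint.fg_adjoin_singleton
  have : Finite (Algebra.adjoin (ZMod p) {z}) := Module.finite_of_finite (ZMod p)
  let y : Algebra.adjoin (ZMod p) {z} := ⟨z, Algebra.subset_adjoin rfl⟩
  obtain ⟨a, b, hab, he⟩ := Finite.exists_ne_map_eq_of_infinite (fun i : ℕ => y ^ p ^ i)
  have he' : z ^ p ^ a = z ^ p ^ b := by
    have := congrArg (fun t : Algebra.adjoin (ZMod p) {z} => (t : R)) he
    simpa [y] using this
  have key : ∀ a b : ℕ, a < b → z ^ p ^ a = z ^ p ^ b → ∃ m : ℕ, 1 ≤ m ∧ z ^ p ^ m = z := by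
    intro a b hlt he
    refine ⟨b - a, by omega, ?_⟩
    apply iterateFrobenius_inj R p a
    rw [iterateFrobenius_def, iterateFrobenius_def, ← pow_mul, ← pow_add, Nat.sub_add_cancel hlt.le, he]
  rcases lt_or_gt_of_ne hab with h | h
  · exact key a b h he'
  · exact key b a h he'.symm

theorem exists_int_poly (f : ℚ_[p][X]) (hf : f ≠ 0) (z : E) (hz : f.eval₂ θ z = 0) :
    ∃ (g : ℤ_[p][X]) (k : ℕ), g.coeff k = 1 ∧
      g.eval₂ (θ.comp (PadicInt.Coe.ringHom (p := p))) z = 0 := by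
  obtain ⟨k, hk, hmax⟩ := Finset.exists_max_image f.support (fun i => ‖f.coeff i‖)
    (Polynomial.support_nonempty.2 hf)
  have hk0 : f.coeff k ≠ 0 := Polynomial.mem_support_iff.1 hk
  have hl : C (f.coeff k)⁻¹ * f ∈ Polynomial.lifts (PadicInt.Coe.ringHom (p := p)) := by
    rw [Polynomial.lifts_iff_coeff_lifts]
    intro i
    have : ‖(f.coeff k)⁻¹ * f.coeff i‖ ≤ 1 := by
      rw [norm_mul, norm_inv]
      by_cases hi : i ∈ f.support
      · rw [inv_mul_le_one₀ (norm_pos_iff.2 hk0)]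
        exact hmax i hi
      · rw [Polynomial.notMem_support_iff.1 hi]; simp
    exact ⟨⟨_, this⟩, by rw [coeff_C_mul]; rfl⟩
  rw [Polynomial.mem_lifts] at hl
  obtain ⟨g, hg⟩ := hl
  refine ⟨g, k, ?_, ?_⟩
  · have := congrArg (fun q => q.coeff k) hg
    simp only [coeff_map, coeff_C_mul, inv_mul_cancel₀ hk0] at this
    exact Subtype.ext this
  · rw [← eval₂_map, hg, eval₂_mul, hz, mul_zero]

theorem frob_fix (hp : 0 < w (p : E)) (z : E) (hz : 0 ≤ w z)
    (hint : ∃ f : ℚ_[p][X], f ≠ 0 ∧ f.eval₂ θ z = 0) :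
    ∃ m : ℕ, 1 ≤ m ∧ 0 < w (z ^ p ^ m - z) := by
  obtain ⟨f, hf, hfz⟩ := hint
  obtain ⟨g, k, hk, hg⟩ := exists_int_poly p θ f hf z hfz
  have := char_res w p hp
  let θ' := (θ.comp (PadicInt.Coe.ringHom (p := p))).codRestrict (OO w) (fun a => w_nonneg w p θ a)
  let y : OO w := ⟨z, hz⟩
  have h1 : g.eval₂ θ' y = 0 := by
    apply Subtype.ext
    change (OO w).subtype (g.eval₂ θ' y) = 0
    rw [hom_eval₂]
    exact hg
  have h2 : g.eval₂ (rho w p θ) (Ideal.Quotient.mk (II w) y) = 0 := by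
    have := congrArg (Ideal.Quotient.mk (II w)) h1
    rw [hom_eval₂, map_zero] at this
    exact this
  obtain ⟨m, hm, he⟩ := frob_per p (rho w p θ) _ g k hk h2
  refine ⟨m, hm, ?_⟩
  rw [← map_pow, Ideal.Quotient.eq, mem_II] at he
  exact he
end
end HA

namespace HA
section
variable {K E : Type} [Field K] [Field E] [Algebra K E] [FiniteDimensional K E] [IsGalois K E]
  (w : AddValuation E (WithTop ℤ)) (p : ℕ) [hpp : Fact p.Prime]

theorem pos_add {a b : E} (ha : 0 < w a) (hb : 0 < w b) : 0 < w (a + b) := w.map_lt_add ha hb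

theorem res_approx (hp : 0 < w (p : E)) (hC : ∀ (σ : E ≃ₐ[K] E) z, 0 ≤ w z → 0 < w (σ z - z))
    (n : ℕ) (hcard : Nat.card (E ≃ₐ[K] E) = (p - 1) * p ^ n) (z : E) (hz : 0 ≤ w z) :
    ∃ c : K, 0 < w (z ^ p ^ n - algebraMap K E c) := by
  classical
  have := char_res w p hp
  have hσ : ∀ σ : E ≃ₐ[K] E, 0 ≤ w (σ z) := by
    intro σ
    have : σ z = (σ z - z) + z := by ring
    rw [this]
    exact w.map_le_add (hC σ z hz).le hz
  let Y : (E ≃ₐ[K] E) → OO w := fun σ => ⟨σ z, hσ σ⟩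
  let y : OO w := ⟨z, hz⟩
  have hY : ∀ σ, Ideal.Quotient.mk (II w) (Y σ) = Ideal.Quotient.mk (II w) y := by
    intro σ
    rw [Ideal.Quotient.eq, mem_II]
    exact hC σ z hz
  let e := MvPolynomial.aeval (fun σ : E ≃ₐ[K] E => σ z) (MvPolynomial.esymm (E ≃ₐ[K] E) ℤ (p ^ n))
  have he : e ∈ Set.range (algebraMap K E) := by
    rw [IsGalois.mem_range_algebraMap_iff_fixed]
    intro τ
    have h1 : τ e = MvPolynomial.aeval (fun σ : E ≃ₐ[K] E => (τ * σ) z)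
        (MvPolynomial.esymm (E ≃ₐ[K] E) ℤ (p ^ n)) := by
      simp [e, MvPolynomial.esymm, map_sum, map_prod]
    have h2 := MvPolynomial.esymm_isSymmetric (E ≃ₐ[K] E) ℤ (p ^ n) (Equiv.mulLeft τ)
    rw [h1]
    change _ = MvPolynomial.aeval (fun σ : E ≃ₐ[K] E => σ z) (MvPolynomial.esymm (E ≃ₐ[K] E) ℤ (p ^ n))
    conv_rhs => rw [← h2]
    rw [MvPolynomial.aeval_rename]
    rfl
  let e' : OO w := MvPolynomial.aeval Y (MvPolynomial.esymm (E ≃ₐ[K] E) ℤ (p ^ n))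
  have hee : (e' : E) = e := by
    change (OO w).subtype e' = e
    simp [e, e', MvPolynomial.esymm, map_sum, map_prod, Y]
  have hmk : Ideal.Quotient.mk (II w) e' =
      (Nat.choose ((p - 1) * p ^ n) (p ^ n) : ℕ) * (Ideal.Quotient.mk (II w) y) ^ p ^ n := by
    simp only [e', MvPolynomial.esymm, map_sum, map_prod, MvPolynomial.aeval_X, hY]
    rw [Finset.sum_congr rfl (g := fun _ => (Ideal.Quotient.mk (II w) y) ^ p ^ n)]
    · rw [Finset.sum_const, Finset.card_powersetCard, Finset.card_univ, ← Nat.card_eq_fintype_card,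
        hcard, nsmul_eq_mul]
    · intro t ht
      rw [Finset.prod_const, (Finset.mem_powersetCard.1 ht).2]
  have hch : ((Nat.choose ((p - 1) * p ^ n) (p ^ n) : ℕ) : OO w ⧸ II w) = -1 := by
    have h1 : Nat.choose (p ^ n * (p - 1)) (p ^ n * 1) ≡ Nat.choose (p - 1) 1 [MOD p] :=
      Choose.choose_pow_mul_pow_mul_modEq_choose_nat
    have h2 := (CharP.natCast_eq_natCast (OO w ⧸ II w) p).2 h1
    rw [mul_one, mul_comm, Nat.choose_one_right, Nat.cast_sub hpp.out.one_lt.le] at h2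
    rw [h2]
    simp
  rw [hch, neg_one_mul] at hmk
  obtain ⟨c, hc⟩ := he
  refine ⟨-c, ?_⟩
  have h3 : Ideal.Quotient.mk (II w) (y ^ p ^ n - (-e')) = 0 := by
    rw [map_sub, map_neg, hmk, map_pow]; ring
  rw [Ideal.Quotient.eq_zero_iff_mem, mem_II] at h3
  rw [map_neg, hc, ← hee]
  exact h3

theorem pow_sub_pos {a b : E} (ha : 0 ≤ w a) (hb : 0 ≤ w b) (h : 0 < w (a - b)) (m : ℕ) :
    0 < w (a ^ m - b ^ m) := by
  have h1 : Ideal.Quotient.mk (II w) (⟨a, ha⟩ : OO w) = Ideal.Quotient.mk (II w) (⟨b, hb⟩ : OO w) := by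
    rw [Ideal.Quotient.eq, mem_II]; exact h
  have h2 := congrArg (fun t => t ^ m) h1
  simp only [← map_pow] at h2
  rw [Ideal.Quotient.eq, mem_II] at h2
  exact h2

theorem res_approx' (hp : 0 < w (p : E)) (hC : ∀ (σ : E ≃ₐ[K] E) z, 0 ≤ w z → 0 < w (σ z - z))
    (n : ℕ) (hcard : Nat.card (E ≃ₐ[K] E) = (p - 1) * p ^ n) (z : E) (hz : 0 ≤ w z)
    (hfr : ∃ m : ℕ, 1 ≤ m ∧ 0 < w (z ^ p ^ m - z)) :
    ∃ c : K, 0 < w (z - algebraMap K E c) := by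
  obtain ⟨m, hm, hfr⟩ := hfr
  have hzp : ∀ k, 0 ≤ w (z ^ k) := fun k => (OO w).pow_mem (x := z) hz k
  have h1 : ∀ k, 0 < w (z ^ p ^ (m * k) - z) := by
    intro k
    induction k with
    | zero => simp
    | succ k ih =>
      have h2 := pow_sub_pos w (hzp _) hz ih (p ^ m)
      rw [← pow_mul, ← pow_add] at h2
      have := pos_add w h2 hfr
      rw [mul_add, mul_one]
      convert this using 2
      ring
  obtain ⟨c, hc⟩ := res_approx w p hp hC n hcard z hz
  have hc0 : 0 ≤ w (algebraMap K E c) := by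
    have : algebraMap K E c = z ^ p ^ n - (z ^ p ^ n - algebraMap K E c) := by ring
    rw [this]
    exact w.map_le_sub (hzp _) hc.le
  have h3 := pow_sub_pos w (hzp _) hc0 hc (p ^ (m * n - n))
  rw [← pow_mul, ← pow_add, Nat.add_sub_cancel' (Nat.le_mul_of_pos_left n hm)] at h3
  refine ⟨c ^ p ^ (m * n - n), ?_⟩
  have h4 := h1 n
  rw [← w.map_neg] at h4
  have := pos_add w h4 h3
  rw [map_pow]
  convert this using 2
  ring

theorem inv_of (x : E) (hx : w x = ((1 : ℤ) : WithTop ℤ))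
    (hC : ∀ (σ : E ≃ₐ[K] E) z, 0 ≤ w z → 0 < w (σ z - z)) (σ : E ≃ₐ[K] E) (z : E) : w (σ z) = w z := by
  have hunit : ∀ (σ : E ≃ₐ[K] E) (u : E), w u = ((0 : ℤ) : WithTop ℤ) → w (σ u) = ((0 : ℤ) : WithTop ℤ) := by
    intro σ u hu
    have h1 := hC σ u hu.ge
    refine le_antisymm ?_ ?_
    · by_contra hc
      push Not at hc
      have h2 : 0 < w (σ u + -(σ u - u)) := pos_add w hc (by rwa [w.map_neg])
      rw [show σ u + -(σ u - u) = u by ring, hu] at h2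
      exact lt_irrefl _ h2
    · have h2 : 0 ≤ w ((σ u - u) + u) := w.map_le_add h1.le hu.ge
      rwa [sub_add_cancel] at h2
  have hpos : ∀ σ : E ≃ₐ[K] E, ∃ k : ℤ, 1 ≤ k ∧ w (σ x) = (k : WithTop ℤ) := by
    intro σ
    have hx0 : σ x ≠ 0 := by simpa using ne_zero_of w hx
    obtain ⟨k, hk⟩ := exists_int w hx0
    refine ⟨k, ?_, hk⟩
    have hxp : 0 < w x := by rw [hx]; exact WithTop.coe_lt_coe.2 one_pos
    have h2 : 0 < w ((σ x - x) + x) := pos_add w (hC σ x hxp.le) hxp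
    rw [sub_add_cancel, hk] at h2
    exact WithTop.coe_lt_coe.1 h2
  have hx1 : ∀ σ : E ≃ₐ[K] E, w (σ x) = ((1 : ℤ) : WithTop ℤ) := by
    intro σ
    obtain ⟨k, hk1, hk⟩ := hpos σ
    obtain ⟨l, hl1, hl⟩ := hpos σ⁻¹
    have h1 : w (σ x / x ^ k) = ((0 : ℤ) : WithTop ℤ) := by
      rw [w_div w hk (w_zpow w hx k)]; simp
    have h2 := hunit σ⁻¹ _ h1
    have h3 : σ⁻¹ (σ x / x ^ k) = x / (σ⁻¹ x) ^ k := by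
      rw [map_div₀, map_zpow₀]
      congr 1
      change (σ⁻¹ * σ) x = x
      simp
    rw [h3, w_div w hx (w_zpow w hl k), WithTop.coe_inj] at h2
    have : k = 1 := by nlinarith
    rw [hk, this]
  by_cases hz : z = 0
  · subst hz; simp
  obtain ⟨k, hk⟩ := exists_int w hz
  have h1 : w (z / x ^ k) = ((0 : ℤ) : WithTop ℤ) := by
    rw [w_div w hk (w_zpow w hx k)]; simp
  have h2 := hunit σ _ h1
  have h3 : σ z = σ (z / x ^ k) * (σ x) ^ k := by
    rw [← map_zpow₀, ← map_mul, div_mul_cancel₀]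
    exact zpow_ne_zero _ (ne_zero_of w hx)
  rw [h3, w_mul w h2 (w_zpow w (hx1 σ) k), hk]
  simp
end
end HA

namespace HA
section
variable {p : ℕ} {A : Type} [Field A] (vd : PadicValData A p)

theorem v_zpow {E : Type} [Field E] (v : AddValuation E (WithTop ℚ)) {x : E} {c : ℚ}
    (hx : v x = (c : WithTop ℚ)) (k : ℤ) : v (x ^ k) = ((k * c : ℚ) : WithTop ℚ) := by
  have hx0 : x ≠ 0 := by rintro rfl; simp at hx
  have hn : ∀ m : ℕ, v (x ^ m) = ((m * c : ℚ) : WithTop ℚ) := by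
    intro m
    rw [v.map_pow, hx, ← WithTop.coe_nsmul]; simp
  obtain ⟨m, rfl | rfl⟩ := k.eq_nat_or_neg
  · rw [zpow_natCast, hn]; simp
  · have h1 : v (x ^ (-(m : ℤ))) ≠ ⊤ := v.ne_top_iff.2 (zpow_ne_zero _ hx0)
    obtain ⟨a, ha⟩ := WithTop.ne_top_iff_exists.1 h1
    have h2 : v (x ^ m * x ^ (-(m : ℤ))) = 0 := by
      rw [zpow_neg, zpow_natCast, mul_inv_cancel₀ (pow_ne_zero _ hx0)]; simp
    rw [v.map_mul, hn, ← ha, ← WithTop.coe_add, ← WithTop.coe_zero, WithTop.coe_inj] at h2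
    rw [← ha, WithTop.coe_inj]
    push_cast
    linarith

theorem exists_cmp {F : Type} [Field F] (emb : F →+* A) (x : F) (hx : 0 < av vd emb x)
    (hmin : ∀ y, 0 < av vd emb y → av vd emb x ≤ av vd emb y) :
    ∃ w c, Cmp vd emb w c ∧ w x = ((1 : ℤ) : WithTop ℤ) := by
  have h1 : av vd emb x ≠ ⊤ := by
    intro h
    have h2 := hmin (p : F) (by rw [av_p]; exact zero_lt_one)
    rw [h, av_p, top_le_iff] at h2
    exact WithTop.one_ne_top h2
  obtain ⟨c, hc⟩ := WithTop.ne_top_iff_exists.1 h1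
  rw [← hc, ← WithTop.coe_zero, WithTop.coe_lt_coe] at hx
  have hx0 : x ≠ 0 := by rintro rfl; simp at h1
  obtain ⟨w, hw⟩ := exists_div (av vd emb) c hx (by
    intro z hz
    obtain ⟨q, hq⟩ := WithTop.ne_top_iff_exists.1 ((av vd emb).ne_top_iff.2 hz)
    refine ⟨⌊q / c⌋, ?_⟩
    have e1 : av vd emb (z * x ^ (-⌊q / c⌋)) = ((q - ⌊q / c⌋ * c : ℚ) : WithTop ℚ) := by
      rw [(av vd emb).map_mul, ← hq, v_zpow _ hc.symm, ← WithTop.coe_add, WithTop.coe_inj]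
      push_cast; ring
    have hge : (⌊q / c⌋ : ℚ) * c ≤ q := by
      rw [← le_div_iff₀ hx]; exact Int.floor_le _
    have hlt : q < (⌊q / c⌋ + 1 : ℚ) * c := by
      rw [← div_lt_iff₀ hx]; exact Int.lt_floor_add_one _
    rcases hge.lt_or_eq with h | h
    · have := hmin (z * x ^ (-⌊q / c⌋)) (by
        rw [e1, ← WithTop.coe_zero, WithTop.coe_lt_coe]; linarith)
      rw [e1, ← hc, WithTop.coe_le_coe] at this
      linarith
    · rw [← hq, h])
  refine ⟨w, c, ⟨hx, hw⟩, ?_⟩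
  rw [hw, ← hc]; simp

variable {F : Type} [Field F] (emb : F →+* A)

theorem imp_of_no_unif (hno : ∀ x, 0 < av vd emb x → ∃ y, 0 < av vd emb y ∧ av vd emb y < av vd emb x)
    (j : ℕ) : ∀ z : F, 0 < av vd emb z → InMaxIdealPow vd emb j (emb z) := by
  induction j with
  | zero =>
    intro z hz
    rw [imp_iff]
    exact ⟨z, Fin.elim0, hz.le, fun k => k.elim0, by simp⟩
  | succ j ih =>
    intro z hz
    obtain ⟨y, hy, hyz⟩ := hno z hz
    have hy0 : y ≠ 0 := by
      rintro rfl
      simp at hyz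
    obtain ⟨a, ha⟩ := WithTop.ne_top_iff_exists.1 ((av vd emb).ne_top_iff.2 hy0)
    have hb : 0 < av vd emb (z / y) := by
      have h1 : av vd emb z = av vd emb (z / y) + av vd emb y := by
        rw [← (av vd emb).map_mul, div_mul_cancel₀ _ hy0]
      rw [h1] at hyz
      by_contra hc
      push Not at hc
      have := add_le_add_left hc (av vd emb y)
      rw [zero_add] at this
      exact absurd hyz (not_lt.2 this)
    have h2 := ih y hy
    rw [imp_iff] at h2 ⊢
    obtain ⟨u, s, hu, hs, he⟩ := h2
    refine ⟨u, Fin.snoc s (z / y), hu, ?_, ?_⟩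
    · intro k
      refine Fin.lastCases ?_ ?_ k
      · simpa using hb
      · intro k; simpa using hs k
    · rw [Fin.prod_univ_castSucc]
      simp only [Fin.snoc_castSucc, Fin.snoc_last]
      rw [← mul_assoc, ← he, mul_div_cancel₀ _ hy0]

variable (K L : Type) [Field K] [Field L] [Algebra K L] [FiniteDimensional K L] [IsGalois K L]
  (emb : L →+* A)

theorem up_zero : upperRamSet vd K L emb 0 = lowerRamSet vd K L emb 0 := by
  rw [upperRamSet]
  simp [psi_zero]

theorem psi_pos (y : ℝ) (hy : 0 < y) : 0 < herbrandPsi vd K L emb y := by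
  have := psi_mono vd K L emb hy
  rwa [psi_zero] at this

theorem low_zero (n : ℕ) (h : RamCond vd K L emb n) : lowerRamSet vd K L emb 0 = Set.univ := by
  rw [← up_zero]; exact h.2.1

theorem exists_unif (hp : Odd p) (n : ℕ) (h : RamCond vd K L emb n) :
    ∃ x : L, 0 < av vd emb x ∧ ∀ y, 0 < av vd emb y → av vd emb x ≤ av vd emb y := by
  by_contra hc
  push Not at hc
  have h1 := imp_of_no_unif vd emb hc
  have h2 : upperRamSet vd K L emb 1 = upperRamSet vd K L emb 0 := by
    rw [h.2.1, Set.eq_univ_iff_forall]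
    intro σ z hz
    have h3 : σ ∈ lowerRamSet vd K L emb 0 := by rw [low_zero vd K L emb n h]; trivial
    have h4 := h3 z hz
    rw [← map_sub] at h4 ⊢
    rw [show ((0 : ℤ) + 1).toNat = 1 from rfl, imp_iff] at h4
    apply h1
    obtain ⟨u, s, hu, hs, he⟩ := h4
    rw [he]
    simp only [Fin.prod_univ_one, (av vd emb).map_mul]
    exact lt_of_lt_of_le (hs 0) (le_add_of_nonneg_left hu)
  have h3 := h.2.2.2.1
  rw [h2] at h3
  have h4 : 0 < Nat.card (upperRamSet vd K L emb 0) := card_pos_low vd K L emb _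
  have h5 : p - 1 = 1 := by
    by_contra h6
    have : (p - 1) * Nat.card (upperRamSet vd K L emb 0) = 1 * Nat.card (upperRamSet vd K L emb 0) := by
      rw [← h3, one_mul]
    exact h6 (Nat.eq_of_mul_eq_mul_right h4 this)
  obtain ⟨k, rfl⟩ := hp
  omega

theorem card_up (n : ℕ) (h : RamCond vd K L emb n) (k : ℕ) (hk1 : k ≤ n) :
    Nat.card (upperRamSet vd K L emb ((n + 1 - k : ℕ) : ℤ)) = p ^ k := by
  induction k with
  | zero =>
    have := h.2.2.2.2.2
    have e : ((n + 1 - 0 : ℕ) : ℤ) = n + 1 := by simp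
    rw [e, this]; simp
  | succ k ih =>
    have h1 := h.2.2.2.2.1 (n - k) (by omega) (by omega)
    have e1 : ((n + 1 - (k + 1) : ℕ) : ℤ) = ((n - k : ℕ) : ℤ) := by congr 1; omega
    have e2 : ((n - k : ℕ) : ℤ) + 1 = ((n + 1 - k : ℕ) : ℤ) := by omega
    rw [e1, h1, e2, ih (by omega), pow_succ']

theorem card_G (n : ℕ) (h : RamCond vd K L emb n) : Nat.card (L ≃ₐ[K] L) = (p - 1) * p ^ n := by
  have h1 := h.2.2.2.1
  have h2 := card_up vd K L emb n h n le_rfl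
  have e : ((n + 1 - n : ℕ) : ℤ) = 1 := by omega
  rw [e] at h2
  rw [h2, h.2.1] at h1
  simpa using h1

theorem exists_TR [hpp : Fact p.Prime] [Algebra ℚ_[p] K] [FiniteDimensional ℚ_[p] K] (hp : Odd p)
    (n : ℕ) (h : RamCond vd K L emb n) :
    ∃ w c x, Cmp vd emb w c ∧ TR p K L w x := by
  obtain ⟨x, hx, hmin⟩ := exists_unif vd K L emb hp n h
  obtain ⟨w, c, hc, hwx⟩ := exists_cmp vd emb x hx hmin
  have hC : ∀ (σ : L ≃ₐ[K] L) z, 0 ≤ w z → 0 < w (σ z - z) := by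
    intro σ z hz
    have h3 : σ ∈ lowerRamSet vd K L emb 0 := by rw [low_zero vd K L emb n h]; trivial
    have h4 := h3 z ((hc.le_iff z).2 hz)
    rw [← map_sub, show ((0 : ℤ) + 1).toNat = 1 from rfl, imp_iff] at h4
    obtain ⟨u, s, hu, hs, he⟩ := h4
    refine (hc.lt_iff _).1 ?_
    rw [he]
    simp only [Fin.prod_univ_one, (av vd emb).map_mul]
    exact lt_of_lt_of_le (hs 0) (le_add_of_nonneg_left hu)
  have hpw : 0 < w (p : L) := (hc.lt_iff _).1 (by rw [av_p]; exact zero_lt_one)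
  let _ : Algebra ℚ_[p] L := ((algebraMap K L).comp (algebraMap ℚ_[p] K)).toAlgebra
  have : IsScalarTower ℚ_[p] K L := IsScalarTower.of_algebraMap_eq fun _ => rfl
  have : FiniteDimensional ℚ_[p] L := FiniteDimensional.trans ℚ_[p] K L
  refine ⟨w, c, x, hc, inv_of w x hwx hC, hwx, ?_, hpw, ?_⟩
  · intro z hz
    refine res_approx' w p hpw hC n (card_G vd K L emb n h) z hz.ge ?_
    refine frob_fix w p (algebraMap ℚ_[p] L) hpw z hz.ge ?_
    have hi : IsIntegral ℚ_[p] z := Algebra.IsIntegral.isIntegral z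
    exact ⟨minpoly ℚ_[p] z, minpoly.ne_zero hi, minpoly.aeval ℚ_[p] z⟩
  · have : (p : L) = algebraMap ℚ_[p] L p := by simp
    rw [this, Ne, map_eq_zero]
    exact_mod_cast hpp.out.ne_zero
end
end HA

namespace HA
section

/-- truncation -/
def mi (t : WithTop ℤ) (a : ℤ) : ℤ := (min t (a : WithTop ℤ)).untopD 0

theorem mi_coe (t : WithTop ℤ) (a : ℤ) : ((mi t a : ℤ) : WithTop ℤ) = min t a := by
  induction t using WithTop.recTopCoe with
  | top => simp [mi]
  | coe t =>
    rw [mi, ← WithTop.coe_min, WithTop.untopD_coe]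

theorem mi_succ (t : WithTop ℤ) (a : ℤ) [Decidable (((a + 1 : ℤ) : WithTop ℤ) ≤ t)] :
    mi t (a + 1) = mi t a + if ((a + 1 : ℤ) : WithTop ℤ) ≤ t then 1 else 0 := by
  split_ifs with h
  · revert h
    induction t using WithTop.recTopCoe with
    | top => simp [mi]
    | coe t =>
      simp only [mi, ← WithTop.coe_min, WithTop.untopD_coe, WithTop.coe_le_coe]
      omega
  · revert h
    induction t using WithTop.recTopCoe with
    | top => simp
    | coe t =>
      simp only [mi, ← WithTop.coe_min, WithTop.untopD_coe, WithTop.coe_le_coe]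
      omega

theorem mi_one (t : WithTop ℤ) (h : ((1 : ℤ) : WithTop ℤ) ≤ t) : mi t 1 = 1 := by
  have := mi_coe t 1
  rw [min_eq_right h] at this
  exact_mod_cast this

variable {p : ℕ} {A : Type} [Field A] {vd : PadicValData A p}
  {K L : Type} [Field K] [Field L] [Algebra K L] [FiniteDimensional K L] [IsGalois K L]
  {emb : L →+* A} {w : AddValuation L (WithTop ℤ)} {c : ℚ} {x : L}

theorem low_zero' (hc : Cmp vd emb w c) (hT : TR p K L w x) : lowerRamSet vd K L emb 0 = Set.univ := by
  rw [Set.eq_univ_iff_forall]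
  intro σ
  have := hc.low_iff hT 0 σ
  rw [Nat.cast_zero] at this
  rw [this]
  exact hT.i_pos σ

theorem phi_const (a b : ℕ) (hab : a ≤ b) (C : ℕ)
    (h : ∀ u : ℕ, a < u → u ≤ b → Nat.card (lowerRamSet vd K L emb (u : ℤ)) = C) :
    herbrandPhi vd K L emb b = herbrandPhi vd K L emb a +
      (b - a) * (C / Nat.card (lowerRamSet vd K L emb 0)) := by
  induction b, hab using Nat.le_induction with
  | base => simp
  | succ b hab ih =>
    have h1 := phi_succ vd K L emb (b : ℤ)
    have e1 : (((b : ℤ) + 1 : ℤ) : ℝ) = ((b + 1 : ℕ) : ℝ) := by push_cast; ring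
    have e2 : ((b : ℤ) + 1) = ((b + 1 : ℕ) : ℤ) := by push_cast; ring
    rw [e1, e2, h (b + 1) (by omega) le_rfl, Int.cast_natCast, ih (fun u hu hub => h u hu (by omega))] at h1
    rw [h1]; push_cast; ring

theorem phi_sum (hc : Cmp vd emb w c) (hT : TR p K L w x) (a : ℕ) :
    (herbrandPhi vd K L emb a + 1) * Nat.card (L ≃ₐ[K] L) =
      ((∑ σ : L ≃ₐ[K] L, mi (w (σ x - x)) (a + 1) : ℤ) : ℝ) := by
  classical
  have hpos : (0 : ℝ) < Nat.card (L ≃ₐ[K] L) := by exact_mod_cast Nat.card_pos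
  induction a with
  | zero =>
    rw [Nat.cast_zero, phi_zero]
    have : ∀ σ : L ≃ₐ[K] L, mi (w (σ x - x)) (((0 : ℕ) : ℤ) + 1) = 1 := fun σ => mi_one _ (hT.i_pos σ)
    rw [Finset.sum_congr rfl fun σ _ => this σ]
    simp
  | succ a ih =>
    have h1 := phi_succ vd K L emb (a : ℤ)
    have e1 : (((a : ℤ) + 1 : ℤ) : ℝ) = ((a + 1 : ℕ) : ℝ) := by push_cast; ring
    have e2 : ((a : ℤ) + 1) = ((a + 1 : ℕ) : ℤ) := by push_cast; ring
    rw [e1, e2, Int.cast_natCast, low_zero' hc hT] at h1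
    have h2 : Nat.card (Set.univ : Set (L ≃ₐ[K] L)) = Nat.card (L ≃ₐ[K] L) := Nat.card_univ
    rw [h2] at h1
    have h3 : (Nat.card (lowerRamSet vd K L emb ((a + 1 : ℕ) : ℤ)) : ℤ) =
        ∑ σ : L ≃ₐ[K] L, if ((((a + 1 : ℕ) : ℤ) + 1 : ℤ) : WithTop ℤ) ≤ w (σ x - x) then (1 : ℤ) else 0 := by
      rw [Finset.sum_boole, Nat.card_coe_set_eq, Set.ncard_eq_toFinset_card']
      congr 2
      ext σ
      simp only [Set.mem_toFinset, Finset.mem_filter, Finset.mem_univ, true_and]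
      exact hc.low_iff hT (a + 1) σ
    have h4 : (∑ σ : L ≃ₐ[K] L, mi (w (σ x - x)) (((a + 1 : ℕ) : ℤ) + 1)) =
        (∑ σ : L ≃ₐ[K] L, mi (w (σ x - x)) ((a : ℤ) + 1)) +
          (Nat.card (lowerRamSet vd K L emb ((a + 1 : ℕ) : ℤ)) : ℤ) := by
      rw [h3, ← Finset.sum_add_distrib]
      refine Finset.sum_congr rfl fun σ _ => ?_
      rw [mi_succ]
      rfl
    rw [h4, Int.cast_add, ← ih, h1, Int.cast_natCast]
    field_simp
    ring

theorem low_sub (hc : Cmp vd emb w c) (hT : TR p K L w x) (m : ℕ) :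
    ∃ S : Subgroup (L ≃ₐ[K] L), ∀ σ, σ ∈ S ↔ σ ∈ lowerRamSet vd K L emb (m : ℤ) := by
  refine ⟨{ carrier := lowerRamSet vd K L emb (m : ℤ), mul_mem' := ?_, one_mem' := ?_, inv_mem' := ?_ },
    fun σ => Iff.rfl⟩
  · intro σ τ hσ hτ
    rw [hc.low_iff hT] at hσ hτ ⊢
    exact (le_min hσ hτ).trans (hT.i_mul σ τ)
  · exact one_mem_low vd K L emb _
  · intro σ hσ
    change σ⁻¹ ∈ lowerRamSet vd K L emb (m : ℤ)
    rw [hc.low_iff hT] at hσ ⊢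
    rwa [hT.i_inv]

theorem up_eq (k : ℕ) : upperRamSet vd K L emb (k : ℤ) =
    lowerRamSet vd K L emb ((⌈herbrandPsi vd K L emb k⌉₊ : ℕ) : ℤ) := by
  rw [upperRamSet, Int.cast_natCast, Int.natCast_ceil_eq_ceil]
  have h := (psi_mono vd K L emb).monotone (Nat.cast_nonneg k)
  rwa [psi_zero] at h

end
end HA

namespace HA
section
theorem strat {G : Type} [Group G] (S : ℕ → Subgroup G) (h0 : S 0 = ⊤) (i : ℕ) (s : G) (hs : s ∉ S i) :
    ∃ j, j < i ∧ s ∈ S j ∧ s ∉ S (j + 1) := by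
  induction i with
  | zero => rw [h0] at hs; exact absurd (Subgroup.mem_top s) hs
  | succ i ih =>
    by_cases h : s ∈ S i
    · exact ⟨i, by omega, h, hs⟩
    · obtain ⟨j, hj, h1, h2⟩ := ih h
      exact ⟨j, by omega, h1, h2⟩

variable {p : ℕ} {A : Type} [Field A] {vd : PadicValData A p}
  {K L : Type} [Field K] [Field L] [Algebra K L] [FiniteDimensional K L] [IsGalois K L]
  {emb : L →+* A} {w : AddValuation L (WithTop ℤ)} {c : ℚ} {x : L}

theorem core (hpp : p.Prime) (hc : Cmp vd emb w c) (hT : TR p K L w x)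
    (hab : ∀ σ τ : L ≃ₐ[K] L, σ * τ = τ * σ)
    (n : ℕ) (hram : RamCond vd K L emb n) :
    ∃ S : ℕ → Subgroup (L ≃ₐ[K] L),
      (∀ k σ, σ ∈ S k ↔ σ ∈ upperRamSet vd K L emb (k : ℤ)) ∧ Antitone S ∧ S 0 = ⊤ ∧
      (∀ k, k ≤ n → (S (k + 1)).index = (p - 1) * p ^ k) ∧
      (∀ k, k ≤ n → ∀ σ, σ ∈ S k → σ ∉ S (k + 1) → w (σ x - x) = (((p : ℤ) ^ k : ℤ) : WithTop ℤ)) := by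
  classical
  have hex : ∀ k : ℕ, ∃ S : Subgroup (L ≃ₐ[K] L), ∀ σ, σ ∈ S ↔ σ ∈ upperRamSet vd K L emb (k : ℤ) := by
    intro k
    rw [up_eq]
    exact low_sub hc hT _
  choose S hS using hex
  have hanti : Antitone S := by
    apply antitone_nat_of_succ_le
    intro k σ hσ
    rw [hS] at hσ ⊢
    exact hram.2.2.1 k (by exact_mod_cast hσ)
  have hS0 : S 0 = ⊤ := by
    rw [eq_top_iff]
    intro σ _
    rw [hS, Nat.cast_zero, hram.2.1]; trivial
  have hcard : ∀ k, Nat.card (S k) = Nat.card (upperRamSet vd K L emb (k : ℤ)) := by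
    intro k
    exact Nat.card_congr (Equiv.subtypeEquivRight (hS k))
  have hcardS : ∀ k, k ≤ n → Nat.card (S (k + 1)) = p ^ (n - k) := by
    intro k hk
    rw [hcard, ← card_up vd K L emb n hram (n - k) (by omega)]
    congr 4
    omega
  have hG := card_G vd K L emb n hram
  have hidx : ∀ k, k ≤ n → (S (k + 1)).index = (p - 1) * p ^ k := by
    intro k hk
    have h1 := (S (k + 1)).card_mul_index
    rw [hcardS k hk, hG] at h1
    have h2 : (p - 1) * p ^ n = p ^ (n - k) * ((p - 1) * p ^ k) := by
      have : p ^ n = p ^ (n - k) * p ^ k := by rw [← pow_add]; congr 1; omega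
      rw [this]; ring
    rw [h2] at h1
    exact Nat.eq_of_mul_eq_mul_left (pow_pos hpp.pos _) h1
  have hmem : ∀ k σ, σ ∈ S k ↔ ((⌈herbrandPsi vd K L emb k⌉₊ + 1 : ℤ) : WithTop ℤ) ≤ w (σ x - x) := by
    intro k σ
    rw [hS, up_eq, hc.low_iff hT]
  have hpow : ∀ k σ, σ ∈ S (k + 1) → σ ^ p ^ n = 1 := by
    intro k σ hσ
    have h1 : σ ∈ S (0 + 1) := hanti (by omega) hσ
    have h3 : (⟨σ, h1⟩ : S (0 + 1)) ^ Nat.card (S (0 + 1)) = 1 := pow_card_eq_one'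
    rw [hcardS 0 (by omega), Nat.sub_zero] at h3
    exact congrArg Subtype.val h3
  have hnd : ¬ p ∣ p - 1 := fun h => by
    have := Nat.le_of_dvd (Nat.sub_pos_of_lt hpp.one_lt) h
    have := hpp.one_lt
    omega
  -- the tame part
  have htame : ∀ σ, σ ∉ S (0 + 1) → w (σ x - x) = ((1 : ℤ) : WithTop ℤ) := by
    intro σ hσ
    by_contra hne
    have h2 : ((2 : ℤ) : WithTop ℤ) ≤ w (σ x - x) :=
      succ_le_of_lt' (lt_of_le_of_ne (hT.i_pos σ) (Ne.symm hne))
    have h3 : (σ ^ p ^ n) ^ (p - 1) = 1 := by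
      rw [← pow_mul, mul_comm, ← hG]; exact pow_card_eq_one'
    have h4 := hT.faithful _ (hT.tame hpp (σ ^ p ^ n) (h2.trans (hT.i_pow σ _)) (p - 1) hnd h3)
    have hN : (S (0 + 1)).Normal := ⟨fun a ha b => by
      rw [hab b a, mul_assoc, mul_inv_cancel, mul_one]; exact ha⟩
    apply hσ
    rw [← QuotientGroup.eq_one_iff]
    have e1 : ((σ : (L ≃ₐ[K] L) ⧸ S (0 + 1))) ^ (p ^ n) = 1 := by
      rw [← QuotientGroup.mk_pow, h4]; rfl
    have e2 : ((σ : (L ≃ₐ[K] L) ⧸ S (0 + 1))) ^ (p - 1) = 1 := by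
      have : Nat.card ((L ≃ₐ[K] L) ⧸ S (0 + 1)) = p - 1 := by
        have := hidx 0 (by omega)
        rw [pow_zero, mul_one] at this
        exact this
      rw [← this]; exact pow_card_eq_one'
    have e3 := pow_gcd_eq_one.2 ⟨e1, e2⟩
    have e4 : Nat.gcd (p ^ n) (p - 1) = 1 :=
      Nat.Coprime.pow_left _ ((Nat.Prime.coprime_iff_not_dvd hpp).2 hnd)
    rwa [e4, pow_one] at e3
  -- Hasse-Arf
  have hHA : ∀ k, k + 1 ≤ n → ∀ σ, σ ∈ S (k + 1) → σ ∉ S (k + 1 + 1) →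
      ∃ b : ℕ, w (σ x - x) = ((b + 1 : ℤ) : WithTop ℤ) ∧ herbrandPhi vd K L emb b = (k + 1 : ℕ) := by
    intro k hk σ h1 h2
    have hne : σ x - x ≠ 0 := by
      intro h0
      have := hT.faithful σ (sub_eq_zero.1 h0)
      rw [this] at h2
      exact h2 (one_mem _)
    obtain ⟨a, ha⟩ := exists_int w hne
    have ha1 : 1 ≤ a := by
      have := hT.i_pos σ
      rw [ha] at this
      exact WithTop.coe_le_coe.1 this
    obtain ⟨b, rfl⟩ : ∃ b : ℕ, a = b + 1 := ⟨(a - 1).toNat, by omega⟩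
    refine ⟨b, ha, ?_⟩
    have h3 := (hmem _ _).1 h1
    have h4 := (not_congr (hmem _ _)).1 h2
    rw [ha, WithTop.coe_le_coe] at h3 h4
    have h5 : herbrandPsi vd K L emb (k + 1 : ℕ) ≤ b := Nat.ceil_le.1 (by omega)
    have h6 : (b : ℝ) < herbrandPsi vd K L emb (k + 1 + 1 : ℕ) := Nat.lt_ceil.1 (by omega)
    have h7 := (phi_mono vd K L emb).monotone h5
    have h8 := (phi_mono vd K L emb) h6
    rw [phi_psi] at h7 h8
    have h9 := hT.hasse_arf hpp hab σ n (hpow k σ h1) _ ha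
      (fun τ => mi (w (τ x - x)) (b + 1)) (fun τ => mi_coe _ _)
    obtain ⟨d, hd⟩ := h9
    have h10 := phi_sum hc hT b
    rw [hd, ← IsGalois.card_aut_eq_finrank] at h10
    have hpos : (Nat.card (L ≃ₐ[K] L) : ℝ) ≠ 0 := by exact_mod_cast Nat.card_pos.ne'
    have h11 : herbrandPhi vd K L emb b + 1 = (d : ℝ) := by
      push_cast at h10
      rw [mul_comm] at h10
      exact mul_left_cancel₀ hpos h10
    have h12 : herbrandPhi vd K L emb b = ((d - 1 : ℤ) : ℝ) := by push_cast; linarith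
    rw [h12] at h7 h8 ⊢
    have h13 : ((k + 1 : ℕ) : ℤ) ≤ d - 1 := by exact_mod_cast h7
    have h14 : d - 1 < ((k + 1 + 1 : ℕ) : ℤ) := by exact_mod_cast h8
    have h15 : d - 1 = ((k + 1 : ℕ) : ℤ) := by push_cast at *; omega
    rw [h15]; simp
  refine ⟨S, hS, hanti, hS0, hidx, ?_⟩
  -- main induction
  have main : ∀ k, k ≤ n → herbrandPhi vd K L emb ((p ^ k - 1 : ℕ) : ℝ) = (k : ℝ) ∧
      ∀ j, j ≤ k → ∀ σ, σ ∈ S j → σ ∉ S (j + 1) → w (σ x - x) = (((p : ℤ) ^ j : ℤ) : WithTop ℤ) := by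
    intro k
    induction k with
    | zero =>
      intro _
      refine ⟨by simp [phi_zero], ?_⟩
      intro j hj σ _ hσ
      obtain rfl : j = 0 := by omega
      rw [htame σ hσ]; simp
    | succ k ih =>
      intro hk
      obtain ⟨ih1, ih2⟩ := ih (by omega)
      -- nonempty stratum
      have hlt : ∃ σ, σ ∈ S (k + 1) ∧ σ ∉ S (k + 1 + 1) := by
        by_contra hcon
        push Not at hcon
        have h1 : S (k + 1) = S (k + 1 + 1) := le_antisymm hcon (hanti (by omega))
        have h2 := hcardS k (by omega)
        have h3 := hcardS (k + 1) hk
        rw [h1, h3] at h2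
        have := Nat.pow_right_injective hpp.two_le h2
        omega
      obtain ⟨σ₀, h1, h2⟩ := hlt
      obtain ⟨b, hb, hphi⟩ := hHA k hk σ₀ h1 h2
      have hpk : 1 ≤ p ^ k := Nat.one_le_pow _ _ hpp.pos
      have hlt : p ^ k - 1 < b := by
        have : ((p ^ k - 1 : ℕ) : ℝ) < b := by
          rw [← (phi_mono vd K L emb).lt_iff_lt, ih1, hphi]
          push_cast; linarith
        exact_mod_cast this
      have hpsi : herbrandPsi vd K L emb (k + 1 : ℕ) = b := by rw [← hphi, psi_phi]
      have hlow : ∀ u : ℕ, p ^ k - 1 < u → u ≤ b →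
          Nat.card (lowerRamSet vd K L emb (u : ℤ)) = p ^ (n - k) := by
        intro u hu1 hu2
        rw [← hcardS k (by omega)]
        refine Nat.card_congr (Equiv.subtypeEquivRight fun τ => ?_)
        rw [hc.low_iff hT]
        constructor
        · intro hτ
          by_contra hcon
          obtain ⟨j, hj, hj1, hj2⟩ := strat S hS0 _ τ hcon
          rw [ih2 j (by omega) τ hj1 hj2, WithTop.coe_le_coe] at hτ
          have h3 : p ^ j ≤ p ^ k := Nat.pow_le_pow_right hpp.pos (by omega)
          have h4 : ((p ^ j : ℕ) : ℤ) = (p : ℤ) ^ j := by push_cast; rfl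
          rw [← h4] at hτ
          omega
        · intro hτ
          rw [hmem, hpsi, Nat.ceil_natCast] at hτ
          refine le_trans ?_ hτ
          rw [WithTop.coe_le_coe]
          omega
      have hcst := phi_const _ _ hlt.le _ hlow
      rw [hphi, ih1, low_zero' hc hT, Nat.card_univ, hG] at hcst
      have hb2 : (b : ℝ) + 1 = (p : ℝ) ^ (k + 1) := by
        have e1 : (p : ℝ) ^ n = (p : ℝ) ^ (n - k) * (p : ℝ) ^ k := by rw [← pow_add]; congr 1; omega
        push_cast [Nat.cast_sub hpk, Nat.cast_sub hpp.one_lt.le] at hcst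
        rw [e1] at hcst
        have hp1 : (p : ℝ) - 1 ≠ 0 := by
          have : (1 : ℝ) < p := by exact_mod_cast hpp.one_lt
          linarith
        have hp0 : (p : ℝ) ≠ 0 := by exact_mod_cast hpp.ne_zero
        field_simp at hcst
        rw [pow_succ]
        linarith
      have hb3 : b + 1 = p ^ (k + 1) := by exact_mod_cast hb2
      refine ⟨by rw [← hb3, Nat.add_sub_cancel, hphi], ?_⟩
      intro j hj σ hσ1 hσ2
      rcases Nat.lt_or_ge j (k + 1) with hjk | hjk
      · exact ih2 j (by omega) σ hσ1 hσ2
      obtain rfl : j = k + 1 := by omega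
      obtain ⟨b', hb', hphi'⟩ := hHA k hk σ hσ1 hσ2
      have : (b' : ℝ) = b := (phi_mono vd K L emb).injective (by rw [hphi, hphi'])
      have : b' = b := by exact_mod_cast this
      rw [hb', this, WithTop.coe_inj]
      exact_mod_cast hb3
  intro k hk
  exact (main k hk).2 k le_rfl
end
end HA

namespace HA
section
variable {p : ℕ} {A : Type} [Field A] {vd : PadicValData A p}
  {K L : Type} [Field K] [Field L] [Algebra K L] [FiniteDimensional K L] [IsGalois K L]
  {emb : L →+* A} {w : AddValuation L (WithTop ℤ)} {c : ℚ} {x : L}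

theorem fin_step (hpp : p.Prime) (hc : Cmp vd emb w c) (hT : TR p K L w x)
    (hab : ∀ σ τ : L ≃ₐ[K] L, σ * τ = τ * σ)
    (n : ℕ) (hram : RamCond vd K L emb n)
    (i : ℕ) (hi1 : 1 ≤ i) (hi2 : i ≤ n + 1)
    (Ki : IntermediateField K L)
    (hKi : Ki = IntermediateField.fixedField
      (Subgroup.closure (upperRamSet vd K L emb (i : ℤ)))) :
    ∃ T : ℕ → Set (Ki ≃ₐ[K] Ki), (∀ r, r < i → ∀ u : ℕ, p ^ r ≤ u → u ≤ p ^ (r + 1) - 1 →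
      lowerRamSet vd K Ki (emb.comp (Ki.val : Ki →+* L)) (u : ℤ) = T r) ∧
      ∀ r, r ≤ i → herbrandPhi vd K Ki (emb.comp (Ki.val : Ki →+* L)) ((p ^ r - 1 : ℕ) : ℝ) = (r : ℝ) := by
  classical
  obtain ⟨S, hS, hanti, hS0, hidx, hiv⟩ := core hpp hc hT hab n hram
  obtain ⟨N, hN⟩ : ∃ N, N = S i := ⟨_, rfl⟩
  have hcl : Subgroup.closure (upperRamSet vd K L emb (i : ℤ)) = N := by
    have : upperRamSet vd K L emb (i : ℤ) = (N : Set (L ≃ₐ[K] L)) := by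
      ext σ; rw [hN]; exact (hS i σ).symm
    rw [this, Subgroup.closure_eq]
  rw [hcl] at hKi
  have hNn : N.Normal := ⟨fun a ha b => by
      rw [hab b a, mul_assoc, mul_inv_cancel, mul_one]; exact ha⟩
  have hgal : IsGalois K Ki := by rw [hKi]; infer_instance
  obtain ⟨wM, y, hTM, hwM, hsum⟩ := hT.quotN N Ki hKi
  have hNpos : 0 < Nat.card N := Nat.card_pos
  have hcM : Cmp vd (emb.comp (Ki.val : Ki →+* L)) wM (Nat.card N * c) := by
    refine ⟨mul_pos (by exact_mod_cast hNpos) hc.pos, fun z k => ?_⟩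
    have e1 : av vd (emb.comp (Ki.val : Ki →+* L)) z = av vd emb (z : L) := rfl
    have e2 := hc.iff (z : L) (Nat.card N * k)
    rw [e1]
    have e3 : (((Nat.card N * k : ℤ) : ℚ) * c) = k * (Nat.card N * c) := by push_cast; ring
    rw [e3] at e2
    rw [← e2, hwM]
    constructor
    · intro h
      rw [h, ← WithTop.coe_nsmul, nsmul_eq_mul]
    · intro h
      have hz : z ≠ 0 := by
        rintro rfl
        rw [wM.map_zero] at h
        have := ne_zero_of w ((hwM 0).trans (by rw [wM.map_zero]; exact h))
        exact this rfl
      obtain ⟨l, hl⟩ := exists_int wM hz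
      rw [hl, ← WithTop.coe_nsmul, nsmul_eq_mul, WithTop.coe_inj] at h
      rw [hl, WithTop.coe_inj]
      exact mul_left_cancel₀ (by exact_mod_cast hNpos.ne') h
  have hval : ∀ j, j < i → ∀ s, s ∈ S j → s ∉ S (j + 1) →
      wM (AlgEquiv.restrictNormalHom Ki s y - y) = (((p : ℤ) ^ j : ℤ) : WithTop ℤ) := by
    intro j hj s h1 h2
    have h3 : ∀ t : N, w ((s * t) x - x) = (((p : ℤ) ^ j : ℤ) : WithTop ℤ) := by
      intro t
      have ht : (t : L ≃ₐ[K] L) ∈ S i := hN ▸ t.2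
      have ht1 : (t : L ≃ₐ[K] L) ∈ S (j + 1) := hanti (by omega) ht
      refine hiv j (by omega) _ (mul_mem h1 (hanti (by omega) ht)) ?_
      intro h4
      exact h2 ((Subgroup.mul_mem_cancel_right _ ht1).1 h4)
    have h4 := hsum s
    rw [Finset.sum_congr rfl fun (t : N) _ => h3 t, Finset.sum_const, Finset.card_univ,
      ← Nat.card_eq_fintype_card] at h4
    have hne : AlgEquiv.restrictNormalHom Ki s y - y ≠ 0 := by
      intro h0
      rw [h0, wM.map_zero, ← WithTop.coe_nsmul] at h4
      have h5 : Nat.card N • (⊤ : WithTop ℤ) = ⊤ := by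
        obtain ⟨m, hm⟩ := Nat.exists_eq_succ_of_ne_zero hNpos.ne'
        rw [hm, succ_nsmul]; simp
      rw [h5] at h4
      exact WithTop.coe_ne_top h4
    obtain ⟨l, hl⟩ := exists_int wM hne
    rw [hl, ← WithTop.coe_nsmul, ← WithTop.coe_nsmul, nsmul_eq_mul, nsmul_eq_mul, WithTop.coe_inj] at h4
    rw [hl, WithTop.coe_inj]
    exact (mul_left_cancel₀ (by exact_mod_cast hNpos.ne') h4).symm
  have hker : (AlgEquiv.restrictNormalHom (F := K) (K₁ := L) Ki).ker = N := by
    rw [IntermediateField.restrictNormalHom_ker, hKi, IntermediateField.fixingSubgroup_fixedField]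
  have hsurj : Function.Surjective (AlgEquiv.restrictNormalHom (F := K) (K₁ := L) Ki) :=
    AlgEquiv.restrictNormalHom_surjective L
  have hlow : ∀ r, r < i → ∀ u : ℕ, p ^ r ≤ u → u ≤ p ^ (r + 1) - 1 →
      lowerRamSet vd K Ki (emb.comp (Ki.val : Ki →+* L)) (u : ℤ) =
        ((S (r + 1)).map (AlgEquiv.restrictNormalHom (F := K) (K₁ := L) Ki) : Set (Ki ≃ₐ[K] Ki)) := by
    intro r hr u hu1 hu2
    ext τ
    rw [hcM.low_iff hTM]
    constructor
    · intro h
      obtain ⟨s, rfl⟩ := hsurj τ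
      refine ⟨s, ?_, rfl⟩
      by_contra hcon
      obtain ⟨j, hj, hj1, hj2⟩ := strat S hS0 _ s hcon
      rw [hval j (by omega) s hj1 hj2, WithTop.coe_le_coe] at h
      have h3 : p ^ j ≤ p ^ r := Nat.pow_le_pow_right hpp.pos (by omega)
      have h4 : ((p ^ j : ℕ) : ℤ) = (p : ℤ) ^ j := by push_cast; rfl
      rw [← h4] at h
      omega
    · rintro ⟨s, hs, rfl⟩
      by_cases hsN : s ∈ S i
      · have : AlgEquiv.restrictNormalHom (F := K) (K₁ := L) Ki s = 1 := by
          rw [← MonoidHom.mem_ker, hker, hN]; exact hsN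
        rw [this]; simp
      obtain ⟨j, hj, hj1, hj2⟩ := strat S hS0 _ s hsN
      rw [hval j hj s hj1 hj2, WithTop.coe_le_coe]
      have hrj : r + 1 ≤ j := by
        by_contra hcon
        exact hj2 (hanti (by omega) hs)
      have h3 : p ^ (r + 1) ≤ p ^ j := Nat.pow_le_pow_right hpp.pos hrj
      have h4 : ((p ^ j : ℕ) : ℤ) = (p : ℤ) ^ j := by push_cast; rfl
      rw [← h4]
      have : 1 ≤ p ^ (r + 1) := Nat.one_le_pow _ _ hpp.pos
      omega
  refine ⟨_, hlow, ?_⟩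
  intro r
  induction r with
  | zero => intro _; simp [phi_zero]
  | succ r ih =>
    intro hr
    have hpk : 1 ≤ p ^ r := Nat.one_le_pow _ _ hpp.pos
    have hpk1 : 1 ≤ p ^ (r + 1) := Nat.one_le_pow _ _ hpp.pos
    have hle : p ^ r - 1 ≤ p ^ (r + 1) - 1 :=
      Nat.sub_le_sub_right (Nat.pow_le_pow_right hpp.pos (by omega)) 1
    have hcst := phi_const (vd := vd) (K := K) (emb := emb.comp (Ki.val : Ki →+* L)) _ _ hle
      (Nat.card ((S (r + 1)).map (AlgEquiv.restrictNormalHom (F := K) (K₁ := L) Ki))) (by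
        intro u hu1 hu2
        rw [hlow r (by omega) u (by omega) hu2]
        rfl)
    have hidx' : ((S (r + 1)).map (AlgEquiv.restrictNormalHom (F := K) (K₁ := L) Ki)).index =
        (p - 1) * p ^ r := by
      rw [Subgroup.index_map_eq _ hsurj, hidx r (by omega)]
      rw [hker, hN]
      exact hanti (by omega)
    have hmul := ((S (r + 1)).map (AlgEquiv.restrictNormalHom (F := K) (K₁ := L) Ki)).card_mul_index
    rw [hcst, ih (by omega), low_zero' hcM hTM, Nat.card_univ, ← hmul, hidx']
    have hC : (Nat.card ((S (r + 1)).map (AlgEquiv.restrictNormalHom (F := K) (K₁ := L) Ki)) : ℝ) ≠ 0 := by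
      exact_mod_cast Nat.card_pos.ne'
    have hp1 : (p : ℝ) - 1 ≠ 0 := by
      have : (1 : ℝ) < p := by exact_mod_cast hpp.one_lt
      linarith
    have hp0 : (p : ℝ) ≠ 0 := by exact_mod_cast hpp.ne_zero
    push_cast [Nat.cast_sub hpk, Nat.cast_sub hpk1, Nat.cast_sub hpp.one_lt.le]
    field_simp
    ring
end
end HA

section

/-- (Lemma 2.4 i)). Let `L/K` satisfy condition (ram) with parameter `n`,
and let `K_i` be the fixed field of `G^i` for `1 ≤ i ≤ n+1`. Then for `0 ≤ j ≤ i`, the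
Herbrand function satisfies `ψ_{K_i/K}(j) = p^j − 1`; consequently, for any integer `u`
with `p^{j−1} ≤ u ≤ p^j − 1` (and `j ≥ 1`), the lower ramification group `H_u` of
`H := Gal(K_i/K) = G/G^i` equals the upper ramification group `H^j`. -/
theorem statement1 {p : ℕ} [Fact p.Prime] (hp : Odd p)
    {A : Type} [Field A] (vd : PadicValData A p)
    (K L : Type) [Field K] [Field L]
    [Algebra ℚ_[p] K] [FiniteDimensional ℚ_[p] K]
    [Algebra K L] [FiniteDimensional K L] [IsGalois K L]
    (emb : L →+* A)
    (hab : ∀ σ τ : L ≃ₐ[K] L, σ * τ = τ * σ)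
    (n : ℕ) (hram : RamCond vd K L emb n)
    (i : ℕ) (hi1 : 1 ≤ i) (hi2 : i ≤ n + 1)
    (Ki : IntermediateField K L)
    (hKi : Ki = IntermediateField.fixedField
      (Subgroup.closure (upperRamSet vd K L emb (i : ℤ)))) :
    (∀ j : ℕ, j ≤ i →
      herbrandPsi vd K ↥Ki (emb.comp (Ki.val : ↥Ki →+* L)) (j : ℝ) = (p : ℝ) ^ j - 1) ∧
    (∀ j : ℕ, 1 ≤ j → j ≤ i → ∀ u : ℤ,
      (p : ℤ) ^ (j - 1) ≤ u → u ≤ (p : ℤ) ^ j - 1 →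
      lowerRamSet vd K ↥Ki (emb.comp (Ki.val : ↥Ki →+* L)) u
        = upperRamSet vd K ↥Ki (emb.comp (Ki.val : ↥Ki →+* L)) (j : ℤ)) := by
  have hpp : p.Prime := Fact.out
  obtain ⟨w, c, x, hc, hT⟩ := HA.exists_TR vd K L emb hp n hram
  obtain ⟨T, hlow, hphi⟩ := HA.fin_step hpp hc hT hab n hram i hi1 hi2 Ki hKi
  have hpsi : ∀ j : ℕ, j ≤ i →
      herbrandPsi vd K ↥Ki (emb.comp (Ki.val : ↥Ki →+* L)) (j : ℝ) = ((p ^ j - 1 : ℕ) : ℝ) := by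
    intro j hj
    rw [← hphi j hj, HA.psi_phi]
  refine ⟨?_, ?_⟩
  · intro j hj
    rw [hpsi j hj]
    push_cast [Nat.cast_sub (Nat.one_le_pow j p hpp.pos)]
    rfl
  · intro j hj1 hj u hu1 hu2
    obtain ⟨r, rfl⟩ : ∃ r, j = r + 1 := ⟨j - 1, by omega⟩
    rw [upperRamSet, Int.cast_natCast, hpsi _ hj, Int.ceil_natCast]
    have h1 : p ^ r < p ^ (r + 1) := Nat.pow_lt_pow_right hpp.one_lt (by omega)
    rw [hlow r (by omega) _ (by omega) le_rfl]
    rw [Nat.add_sub_cancel] at hu1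
    have e1 : ((p ^ r : ℕ) : ℤ) = (p : ℤ) ^ r := by push_cast; rfl
    have e2 : ((p ^ (r + 1) : ℕ) : ℤ) = (p : ℤ) ^ (r + 1) := by push_cast; rfl
    rw [← e1] at hu1
    rw [← e2] at hu2
    obtain ⟨v, rfl⟩ : ∃ v : ℕ, u = v := ⟨u.toNat, by omega⟩
    exact hlow r (by omega) v (by omega) (by omega)

end
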